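/- arXiv:1702.02648 — 2 statements merged into one kernel-verified Lean document; each statement's English description precedes it below -/
import Mathlib

section
/- For every ε > 0 and every sequence (T_n) of trees with v(T_n) ≤ n, if p = p(n) ≥ (40·Δ(T_n)·ε^{-1}·log n + n^ε)/n, then a.a.s. G(n,p) contains a copy of T_n. -/
open MeasureTheory Filter Topology

/-- Bernoulli measure on `Bool` with success probability `p` (clamped to `[0,1]`). -/
noncomputable def bernoulliMeasure (p : ℝ) : Measure Bool :=
  (min (ENNReal.ofReal p) 1) • Measure.dirac true +
    (1 - min (ENNReal.ofReal p) 1) • Measure.dirac false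

/-- The distribution of the binomial random graph `G(n,p)`, as a product of independent
Bernoulli measures, one for each potential edge. -/
noncomputable def gnp (n : ℕ) (p : ℝ) : Measure (Sym2 (Fin n) → Bool) :=
  Measure.pi fun _ => bernoulliMeasure p

/-- The simple graph on `[n]` determined by an outcome of the edge indicators. -/
def graphOf {n : ℕ} (ω : Sym2 (Fin n) → Bool) : SimpleGraph (Fin n) :=
  SimpleGraph.fromRel fun u v => ω s(u, v) = true

/-- `G` contains a (not necessarily induced) copy of `H`. -/
def ContainsCopy {α β : Type*} (H : SimpleGraph α) (G : SimpleGraph β) : Prop :=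
  ∃ f : α → β, Function.Injective f ∧ ∀ ⦃u v⦄, H.Adj u v → G.Adj (f u) (f v)

/-- The maximum degree of a graph on a finite vertex type. -/
noncomputable def maxDeg {V : Type*} [Fintype V] (G : SimpleGraph V) : ℕ :=
  Finset.univ.sup fun v => (G.neighborSet v).ncard

/-- The maximum 0-density `m₀(H)`. -/
noncomputable def m0 {V : Type*} [Fintype V] (H : SimpleGraph V) : ℝ :=
  sSup {x : ℝ | ∃ H' : H.Subgraph, H'.verts.Nonempty ∧
    x = (H'.edgeSet.ncard : ℝ) / (H'.verts.ncard : ℝ)}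

/-- The maximum 1-density `m₁(H)`. -/
noncomputable def m1 {V : Type*} [Fintype V] (H : SimpleGraph V) : ℝ :=
  sSup {x : ℝ | ∃ H' : H.Subgraph, 1 < H'.verts.ncard ∧
    x = (H'.edgeSet.ncard : ℝ) / ((H'.verts.ncard : ℝ) - 1)}

/-- The maximum 2-density `m₂(H)`. -/
noncomputable def m2 {V : Type*} [Fintype V] (H : SimpleGraph V) : ℝ :=
  sSup {x : ℝ | ∃ H' : H.Subgraph, 0 < H'.edgeSet.ncard ∧
    x = if 2 < H'.verts.ncard
      then ((H'.edgeSet.ncard : ℝ) - 1) / ((H'.verts.ncard : ℝ) - 2)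
      else 1 / 2}

/-- The maximum Riordan-density `m_R(H)`. -/
noncomputable def mR {V : Type*} [Fintype V] (H : SimpleGraph V) : ℝ :=
  sSup {x : ℝ | ∃ H' : H.Subgraph, 2 < H'.verts.ncard ∧
    x = (H'.edgeSet.ncard : ℝ) / ((H'.verts.ncard : ℝ) - 2)}

/-- The local 1-density `m₁(x,H)` of `H` at the vertex `x`. -/
noncomputable def m1At {V : Type*} [Fintype V] (H : SimpleGraph V) (x : V) : ℝ :=
  sSup {r : ℝ | ∃ H' : H.Subgraph, x ∈ H'.verts ∧ 1 < H'.verts.ncard ∧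
    r = (H'.edgeSet.ncard : ℝ) / ((H'.verts.ncard : ℝ) - 1)}

/-- `H` is strictly 1-balanced: `H` itself is the unique maximiser of the 1-density. -/
def StrictlyOneBalanced {V : Type*} [Fintype V] (H : SimpleGraph V) : Prop :=
  ∀ H' : H.Subgraph, 1 < H'.verts.ncard → H' ≠ ⊤ →
    (H'.edgeSet.ncard : ℝ) / ((H'.verts.ncard : ℝ) - 1) <
      (H.edgeSet.ncard : ℝ) / ((Fintype.card V : ℝ) - 1)

/-- `H` is vertex-1-balanced: the local 1-density at every vertex equals `m₁(H)`. -/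
def VertexOneBalanced {V : Type*} [Fintype V] (H : SimpleGraph V) : Prop :=
  ∀ x : V, m1At H x = m1 H

/-- `G` (an `n`-vertex graph) contains an `H`-factor: `⌊n / v(H)⌋` pairwise vertex-disjoint
copies of `H`. -/
def HasFactor {V : Type*} [Fintype V] (H : SimpleGraph V) {n : ℕ}
    (G : SimpleGraph (Fin n)) : Prop :=
  ∃ f : Fin (n / Fintype.card V) × V → Fin n, Function.Injective f ∧
    ∀ (i : Fin (n / Fintype.card V)) ⦃u v : V⦄, H.Adj u v → G.Adj (f (i, u)) (f (i, v))

/-- Expectation of `f` over a `p`-random subset of `s`. -/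
noncomputable def EE {α : Type*} [DecidableEq α] (s : Finset α) (p : ℝ) (f : Finset α → ℝ) : ℝ :=
  ∑ W ∈ s.powerset, p ^ W.card * (1 - p) ^ (s \ W).card * f W

section EEsec
variable {α : Type*} [DecidableEq α]

lemma EE_empty (p : ℝ) (f : Finset α → ℝ) : EE ∅ p f = f ∅ := by simp [EE]

lemma EE_insert {a : α} {s : Finset α} (ha : a ∉ s) (p : ℝ) (f : Finset α → ℝ) :
    EE (insert a s) p f = (1 - p) * EE s p f + p * EE s p (fun W => f (insert a W)) := by
  unfold EE
  rw [Finset.sum_powerset_insert ha, Finset.mul_sum, Finset.mul_sum]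
  congr 1
  · refine Finset.sum_congr rfl fun W hW => ?_
    have hW' := Finset.mem_powerset.1 hW
    have h1 : a ∉ W := fun h => ha (hW' h)
    rw [Finset.insert_sdiff_of_notMem _ h1, Finset.card_insert_of_notMem (by simp [ha])]
    ring
  · refine Finset.sum_congr rfl fun W hW => ?_
    have hW' := Finset.mem_powerset.1 hW
    have h1 : a ∉ W := fun h => ha (hW' h)
    rw [Finset.insert_sdiff_insert, Finset.card_insert_of_notMem h1]
    have : s \ insert a W = s \ W := by
      ext x; simp only [Finset.mem_sdiff, Finset.mem_insert]; 
      constructor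
      · rintro ⟨h, h'⟩; exact ⟨h, fun h2 => h' (Or.inr h2)⟩
      · rintro ⟨h, h'⟩; exact ⟨h, by rintro (rfl | h2); exacts [ha h, h' h2]⟩
    rw [this]
    ring

lemma EE_add (s : Finset α) (p : ℝ) (f g : Finset α → ℝ) :
    EE s p (fun W => f W + g W) = EE s p f + EE s p g := by
  unfold EE; rw [← Finset.sum_add_distrib]; exact Finset.sum_congr rfl fun _ _ => by ring

lemma EE_smul (s : Finset α) (p c : ℝ) (f : Finset α → ℝ) :
    EE s p (fun W => c * f W) = c * EE s p f := by
  unfold EE; rw [Finset.mul_sum]; exact Finset.sum_congr rfl fun _ _ => by ring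

lemma EE_one (s : Finset α) (p c : ℝ) : EE s p (fun _ => c) = c := by
  induction s using Finset.induction_on with
  | empty => simp [EE_empty]
  | insert a s ha ih => rw [EE_insert ha, ih]; ring

lemma EE_mono (s : Finset α) {p : ℝ} (h0 : 0 ≤ p) (h1 : p ≤ 1) {f g : Finset α → ℝ}
    (h : ∀ W, f W ≤ g W) : EE s p f ≤ EE s p g := by
  unfold EE
  have : 0 ≤ 1 - p := by linarith
  exact Finset.sum_le_sum fun W _ => mul_le_mul_of_nonneg_left (h W) (by positivity)

lemma EE_union (s : Finset α) (a b : ℝ) (f : Finset α → ℝ) :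
    EE s (1 - (1 - a) * (1 - b)) f = EE s a (fun W => EE s b (fun W' => f (W ∪ W'))) := by
  induction s using Finset.induction_on generalizing f with
  | empty => simp [EE_empty]
  | insert x s hx ih =>
    rw [EE_insert hx, EE_insert hx]
    simp only [EE_insert hx, ih, EE_add, EE_smul, Finset.insert_union, Finset.union_insert,
      Finset.insert_idem]
    ring

lemma EE_anti (s : Finset α) {a p : ℝ} (h0 : 0 ≤ a) (h1 : a ≤ p) (h2 : p ≤ 1)
    {f : Finset α → ℝ} (hf : ∀ W W', f (W ∪ W') ≤ f W) : EE s p f ≤ EE s a f := by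
  rcases eq_or_lt_of_le (h1.trans h2) with h | h
  · rw [le_antisymm h2 (h ▸ h1), h]
  · have ha : 0 < 1 - a := by linarith
    have hb : p = 1 - (1 - a) * (1 - (p - a) / (1 - a)) := by field_simp; ring
    rw [hb, EE_union]
    refine EE_mono s h0 h.le fun W => ?_
    calc _ ≤ EE s ((p - a) / (1 - a)) (fun _ => f W) :=
          EE_mono s (div_nonneg (by linarith) ha.le) ((div_le_one ha).2 (by linarith))
            fun W' => hf W W'
      _ = f W := EE_one _ _ _
end EEsec

/-- existence of minimal fragments -/
lemma exists_frag {α ι : Type*} [DecidableEq α] (I : Finset ι) (S : ι → Finset α) :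
    ∃ χ : Finset α → ι → Finset α, ∀ W, ∀ i ∈ I,
      (∃ j ∈ I, S j ⊆ W ∪ S i ∧ χ W i = S j \ W) ∧
      ∀ j ∈ I, S j ⊆ W ∪ S i → (χ W i).card ≤ (S j \ W).card := by
  classical
  have : ∀ W : Finset α, ∀ i : ι, ∃ C : Finset α, i ∈ I → 
      (∃ j ∈ I, S j ⊆ W ∪ S i ∧ C = S j \ W) ∧
      ∀ j ∈ I, S j ⊆ W ∪ S i → C.card ≤ (S j \ W).card := by
    intro W i
    by_cases hi : i ∈ I
    · obtain ⟨j, hj, hmin⟩ := Finset.exists_min_image (I.filter fun j => S j ⊆ W ∪ S i)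
        (fun j => (S j \ W).card) ⟨i, by simp [hi]⟩
      rw [Finset.mem_filter] at hj
      exact ⟨S j \ W, fun _ => ⟨⟨j, hj.1, hj.2, rfl⟩, fun k hk hk' =>
        hmin k (by simp [hk, hk'])⟩⟩
    · exact ⟨∅, fun h => absurd h hi⟩
  choose χ hχ using this
  exact ⟨χ, fun W i hi => hχ W i hi⟩

lemma frag_count {α ι : Type*} [Fintype α] [DecidableEq α] [DecidableEq ι]
    (I : Finset ι) (S : ι → Finset α) (N q δ B : ℝ) (l l' : ℕ)
    (hN : 0 ≤ N) (hδ0 : 0 < δ) (hδ1 : δ ≤ 1) (hq : 0 ≤ q)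
    (hS : ∀ i ∈ I, (S i).card ≤ l)
    (hspread : ∀ U : Finset α, ((I.filter fun i => U ⊆ S i).card : ℝ) ≤ q ^ U.card * N)
    (hB : ∀ A : Finset α, A.card ≤ l →
      ∑ C ∈ A.powerset.filter (fun C => l' < C.card), (q / δ) ^ C.card ≤ B)
    (χ : Finset α → ι → Finset α)
    (hχ : ∀ W, ∀ i ∈ I,
      (∃ j ∈ I, S j ⊆ W ∪ S i ∧ χ W i = S j \ W) ∧
      ∀ j ∈ I, S j ⊆ W ∪ S i → (χ W i).card ≤ (S j \ W).card) :
    EE Finset.univ δ (fun W => ((I.filter fun i => l' < (χ W i).card).card : ℝ)) ≤ N * B := by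
  classical
  have hδ' : 0 ≤ 1 - δ := by linarith
  set μ : Finset α → ℝ := fun W => δ ^ W.card * (1 - δ) ^ (Finset.univ \ W).card with hμ
  have hμ0 : ∀ W, 0 ≤ μ W := fun W => by simp only [hμ]; positivity
  -- canonical set
  have hcan : ∀ Z : Finset α, ∃ A : Finset α, A.card ≤ l ∧ 
      ((∃ j ∈ I, S j ⊆ Z) → A ⊆ Z ∧ ∃ j ∈ I, A = S j) := by
    intro Z
    by_cases h : ∃ j ∈ I, S j ⊆ Z
    · obtain ⟨j, hj, hjZ⟩ := h
      exact ⟨S j, hS j hj, fun _ => ⟨hjZ, j, hj, rfl⟩⟩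
    · exact ⟨∅, by simp, fun h' => absurd h' h⟩
  choose can hcan1 hcan2 using hcan
  have hB0 : ∀ Z, ∑ C ∈ (can Z).powerset.filter (fun C => l' < C.card), (q / δ) ^ C.card ≤ B :=
    fun Z => hB _ (hcan1 Z)
  let src : Finset (Finset α × ι) :=
    (Finset.univ ×ˢ I).filter fun x => l' < (χ x.1 x.2).card
  let tgt : Finset (Finset α × Finset α × ι) :=
    Finset.univ.biUnion fun Z => ((can Z).powerset.filter (fun C => l' < C.card)).biUnion fun C =>
      (I.filter fun i => C ⊆ S i).image fun i => (Z, C, i)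
  have e1 : EE Finset.univ δ (fun W => ((I.filter fun i => l' < (χ W i).card).card : ℝ))
      = ∑ x ∈ src, μ x.1 := by
    unfold EE
    simp only [src, Finset.sum_filter, Finset.sum_product, Finset.powerset_univ]
    refine Finset.sum_congr rfl fun W _ => ?_
    rw [Finset.card_filter]; push_cast; rw [Finset.mul_sum]
    exact Finset.sum_congr rfl fun i _ => by split_ifs <;> simp [hμ]
  have key : ∀ x ∈ src, ∃ hh : True, χ x.1 x.2 ⊆ can (x.1 ∪ χ x.1 x.2) ∧ χ x.1 x.2 ⊆ S x.2 ∧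
      Disjoint x.1 (χ x.1 x.2) ∧ x.2 ∈ I ∧ l' < (χ x.1 x.2).card := by
    rintro ⟨W, i⟩ hx
    simp only [src, Finset.mem_filter, Finset.mem_product] at hx
    obtain ⟨⟨-, hi⟩, hl⟩ := hx
    obtain ⟨⟨j, hj, hjs, hjχ⟩, hmin⟩ := hχ W i hi
    have hsub : χ W i ⊆ S i := by
      rw [hjχ]; intro a ha
      rw [Finset.mem_sdiff] at ha
      rcases Finset.mem_union.1 (hjs ha.1) with h | h
      · exact absurd h ha.2
      · exact h
    have hjZ : S j ⊆ W ∪ χ W i := by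
      rw [hjχ]; intro a ha; by_cases h : a ∈ W <;> simp [h, ha]
    obtain ⟨c1, k, hk, ck⟩ := hcan2 (W ∪ χ W i) ⟨j, hj, hjZ⟩
    refine ⟨trivial, ?_, hsub, ?_, hi, hl⟩
    · have h1 : S k ⊆ W ∪ S i := by
        rw [← ck]; exact c1.trans (Finset.union_subset_union_right hsub)
      have h2 := hmin k hk h1
      have h3 : S k \ W ⊆ χ W i := by
        rw [← ck]; intro a ha
        rw [Finset.mem_sdiff] at ha
        rcases Finset.mem_union.1 (c1 ha.1) with h | h
        · exact absurd h ha.2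
        · exact h
      have h4 := Finset.eq_of_subset_of_card_le h3 h2
      show χ W i ⊆ can (W ∪ χ W i)
      rw [ck, ← h4]
      exact Finset.sdiff_subset
    · show Disjoint W (χ W i)
      rw [hjχ]; exact Finset.disjoint_sdiff
  let F : Finset α × ι → Finset α × Finset α × ι := fun x => (x.1 ∪ χ x.1 x.2, χ x.1 x.2, x.2)
  let w : Finset α × Finset α × ι → ℝ := fun y => μ y.1 * (δ⁻¹) ^ y.2.1.card
  have hw0 : ∀ y, 0 ≤ w y := fun y => mul_nonneg (hμ0 _) (by positivity)
  have e2 : ∑ x ∈ src, μ x.1 ≤ ∑ x ∈ src, w (F x) := by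
    refine Finset.sum_le_sum fun x hx => ?_
    obtain ⟨-, k1, k2, k3, k4, k5⟩ := key x hx
    simp only [w, F, hμ]
    rw [Finset.card_union_of_disjoint k3]
    have : (Finset.univ \ x.1).card = (Finset.univ \ (x.1 ∪ χ x.1 x.2)).card + (χ x.1 x.2).card := by
      have h1 : Finset.univ \ x.1 = (Finset.univ \ (x.1 ∪ χ x.1 x.2)) ∪ χ x.1 x.2 := by
        ext a
        simp only [Finset.mem_sdiff, Finset.mem_univ, true_and, Finset.mem_union]
        have : a ∈ x.1 → a ∉ χ x.1 x.2 := fun h => Finset.disjoint_left.1 k3 h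
        tauto
      rw [h1, Finset.card_union_of_disjoint]
      rw [Finset.disjoint_left]; intro a ha ha'
      simp [ha'] at ha
    rw [this, pow_add, pow_add]
    have h3 : δ ^ (χ x.1 x.2).card * δ⁻¹ ^ (χ x.1 x.2).card = 1 := by
      rw [← mul_pow, mul_inv_cancel₀ hδ0.ne', one_pow]
    have h2 : (1 - δ) ^ (χ x.1 x.2).card ≤ 1 := pow_le_one₀ hδ' (by linarith)
    calc _ = δ ^ x.1.card * (1 - δ) ^ (Finset.univ \ (x.1 ∪ χ x.1 x.2)).card
            * (1 - δ) ^ (χ x.1 x.2).card := by ring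
      _ ≤ δ ^ x.1.card * (1 - δ) ^ (Finset.univ \ (x.1 ∪ χ x.1 x.2)).card * 1 :=
          mul_le_mul_of_nonneg_left h2 (by positivity)
      _ = δ ^ x.1.card * (1 - δ) ^ (Finset.univ \ (x.1 ∪ χ x.1 x.2)).card * 
            (δ ^ (χ x.1 x.2).card * δ⁻¹ ^ (χ x.1 x.2).card) := by rw [h3]
      _ = _ := by ring
  have hinj : Set.InjOn F src := by
    rintro x hx y hy hxy
    obtain ⟨-, k1, k2, k3, k4, k5⟩ := key x hx
    obtain ⟨-, m1, m2, m3, m4, m5⟩ := key y hy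
    simp only [F, Prod.mk.injEq] at hxy
    obtain ⟨h1, h2, h3⟩ := hxy
    refine Prod.ext ?_ h3
    have a1 : x.1 = (x.1 ∪ χ x.1 x.2) \ χ x.1 x.2 := by
      rw [Finset.union_sdiff_right, Finset.sdiff_eq_self_of_disjoint k3]
    have a2 : y.1 = (y.1 ∪ χ y.1 y.2) \ χ y.1 y.2 := by
      rw [Finset.union_sdiff_right, Finset.sdiff_eq_self_of_disjoint m3]
    rw [a1, a2, h1, h2]
  have e3 : ∑ x ∈ src, w (F x) ≤ ∑ y ∈ tgt, w y := by
    rw [← Finset.sum_image (f := w) hinj]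
    refine Finset.sum_le_sum_of_subset_of_nonneg ?_ fun y _ _ => hw0 y
    intro y hy
    obtain ⟨x, hx, rfl⟩ := Finset.mem_image.1 hy
    obtain ⟨-, k1, k2, k3, k4, k5⟩ := key x hx
    simp only [tgt, F, Finset.mem_biUnion, Finset.mem_univ, true_and, Finset.mem_image,
      Finset.mem_filter, Finset.mem_powerset]
    exact ⟨_, _, ⟨k1, k5⟩, _, ⟨k4, k2⟩, rfl⟩
  have e4 : ∑ y ∈ tgt, w y ≤ ∑ Z : Finset α, ∑ C ∈ (can Z).powerset.filter (fun C => l' < C.card),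
      ∑ i ∈ I.filter (fun i => C ⊆ S i), w (Z, C, i) := by
    simp only [tgt]
    rw [Finset.sum_biUnion]
    · refine Finset.sum_le_sum fun Z _ => ?_
      rw [Finset.sum_biUnion]
      · refine Finset.sum_le_sum fun C _ => ?_
        rw [Finset.sum_image]
        intro i _ j _ h
        simpa using h
      · intro C _ C' _ hne
        simp only [Function.onFun, Finset.disjoint_left, Finset.mem_image, Finset.mem_filter]
        rintro y ⟨i, _, rfl⟩ ⟨j, _, hj⟩
        simp only [Prod.mk.injEq] at hj
        exact hne hj.2.1.symm
    · intro Z _ Z' _ hne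
      simp only [Function.onFun, Finset.disjoint_left, Finset.mem_biUnion, Finset.mem_image]
      rintro y ⟨C, _, i, _, rfl⟩ ⟨C', _, j, _, hj⟩
      simp only [Prod.mk.injEq] at hj
      exact hne hj.1.symm
  have e5 : ∀ Z : Finset α, ∑ C ∈ (can Z).powerset.filter (fun C => l' < C.card),
      ∑ i ∈ I.filter (fun i => C ⊆ S i), w (Z, C, i) ≤ μ Z * (N * B) := by
    intro Z
    calc _ ≤ ∑ C ∈ (can Z).powerset.filter (fun C => l' < C.card),
          μ Z * N * (q / δ) ^ C.card := by
          refine Finset.sum_le_sum fun C _ => ?_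
          simp only [w, Finset.sum_const, nsmul_eq_mul]
          calc _ ≤ (q ^ C.card * N) * (μ Z * δ⁻¹ ^ C.card) :=
                mul_le_mul_of_nonneg_right (hspread C) (mul_nonneg (hμ0 _) (by positivity))
            _ = _ := by rw [div_eq_mul_inv, mul_pow]; ring
      _ = μ Z * N * ∑ C ∈ (can Z).powerset.filter (fun C => l' < C.card), (q / δ) ^ C.card := by
          rw [Finset.mul_sum]
      _ ≤ μ Z * N * B := mul_le_mul_of_nonneg_left (hB0 Z) (mul_nonneg (hμ0 _) hN)
      _ = _ := by ring
  have e6 : ∑ Z : Finset α, μ Z = 1 := by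
    have := EE_one (Finset.univ : Finset α) δ 1
    unfold EE at this
    simpa [hμ] using this
  calc _ = ∑ x ∈ src, μ x.1 := e1
    _ ≤ _ := e2.trans (e3.trans e4)
    _ ≤ ∑ Z : Finset α, μ Z * (N * B) := Finset.sum_le_sum fun Z _ => e5 Z
    _ = N * B := by rw [← Finset.sum_mul, e6, one_mul]

open Classical in
/-- indicator that no member of the family is contained in `W` -/
noncomputable def failInd {α ι : Type*} (I : Finset ι) (S : ι → Finset α) (W : Finset α) : ℝ :=
  if ∃ i ∈ I, S i ⊆ W then 0 else 1

lemma fail_step {α ι : Type*} [Fintype α] [DecidableEq α]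
    (I : Finset ι) (S : ι → Finset α) (N q δ B p Err : ℝ) (l l' : ℕ)
    (hN : 0 < N) (hδ0 : 0 < δ) (hδ1 : δ ≤ 1) (hq : 0 ≤ q) (hp0 : 0 ≤ p) (hp1 : p ≤ 1)
    (hS : ∀ i ∈ I, (S i).card ≤ l)
    (hspread : ∀ U : Finset α, (((I.filter fun i => U ⊆ S i).card : ℕ) : ℝ) ≤ q ^ U.card * N)
    (hB : ∀ A : Finset α, A.card ≤ l →
      ∑ C ∈ A.powerset.filter (fun C => l' < C.card), (q / δ) ^ C.card ≤ B)
    (ih : ∀ (J : Finset ι) (S' : ι → Finset α), (∀ i ∈ J, (S' i).card ≤ l') →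
      (∀ U : Finset α, (((J.filter fun i => U ⊆ S' i).card : ℕ) : ℝ) ≤ q ^ U.card * N) →
      EE Finset.univ p (failInd J S') ≤ 1 - J.card / N + Err) :
    EE Finset.univ (1 - (1 - δ) * (1 - p)) (failInd I S) ≤ 1 - I.card / N + (B + Err) := by
  classical
  obtain ⟨χ, hχ⟩ := exists_frag I S
  have hfc := frag_count I S N q δ B l l' hN.le hδ0 hδ1 hq hS hspread hB χ hχ
  rw [EE_union]
  have hsub : ∀ W, ∀ i ∈ I, χ W i ⊆ S i := by
    intro W i hi
    obtain ⟨⟨j, hj, hjs, hjχ⟩, -⟩ := hχ W i hi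
    rw [hjχ]; intro a ha
    rw [Finset.mem_sdiff] at ha
    rcases Finset.mem_union.1 (hjs ha.1) with h | h
    · exact absurd h ha.2
    · exact h
  have main : ∀ W, EE Finset.univ p (fun W' => failInd I S (W ∪ W')) ≤
      (1 - I.card / N + Err) + N⁻¹ * ((I.filter fun i => l' < (χ W i).card).card : ℝ) := by
    intro W
    set J := I.filter fun i => ¬ l' < (χ W i).card with hJ
    have h1 : EE Finset.univ p (fun W' => failInd I S (W ∪ W')) ≤
        EE Finset.univ p (failInd J (χ W)) := by
      refine EE_mono _ hp0 hp1 fun W' => ?_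
      unfold failInd
      split_ifs with h h' h'
      · exact le_rfl
      · norm_num
      · exfalso
        obtain ⟨i, hi, hiW⟩ := h'
        obtain ⟨⟨j, hj, hjs, hjχ⟩, -⟩ := hχ W i (Finset.mem_filter.1 hi).1
        refine h ⟨j, hj, fun a ha => ?_⟩
        by_cases haW : a ∈ W
        · simp [haW]
        · exact Finset.mem_union_right _ (hiW (by rw [hjχ]; simp [ha, haW]))
      · exact le_rfl
    have h2 := ih J (χ W) (fun i hi => not_lt.1 (Finset.mem_filter.1 hi).2) (by
      intro U
      refine le_trans ?_ (hspread U)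
      norm_cast
      refine Finset.card_le_card fun i hi => ?_
      simp only [hJ, Finset.mem_filter] at hi ⊢
      exact ⟨hi.1.1, hi.2.trans (hsub W i hi.1.1)⟩)
    have h3 : (I.filter fun i => l' < (χ W i).card).card + J.card = I.card :=
      Finset.card_filter_add_card_filter_not _
    have h4 : (J.card : ℝ) = I.card - (I.filter fun i => l' < (χ W i).card).card := by
      rw [← h3]; push_cast; ring
    refine h1.trans (h2.trans (le_of_eq ?_))
    rw [h4]; field_simp; ring
  calc _ ≤ EE Finset.univ δ (fun W => (1 - I.card / N + Err) +
        N⁻¹ * ((I.filter fun i => l' < (χ W i).card).card : ℝ)) := EE_mono _ hδ0.le hδ1 main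
    _ = (1 - I.card / N + Err) + N⁻¹ * EE Finset.univ δ 
          (fun W => ((I.filter fun i => l' < (χ W i).card).card : ℝ)) := by
        rw [EE_add, EE_one, EE_smul]
    _ ≤ (1 - I.card / N + Err) + N⁻¹ * (N * B) := by gcongr
    _ = _ := by field_simp; ring

lemma fail_base {α ι : Type*} [Fintype α] [DecidableEq α]
    (I : Finset ι) (S : ι → Finset α) (N q : ℝ) (hN : 0 < N)
    (hS : ∀ i ∈ I, (S i).card ≤ 0)
    (hspread : ∀ U : Finset α, (((I.filter fun i => U ⊆ S i).card : ℕ) : ℝ) ≤ q ^ U.card * N) :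
    EE Finset.univ 0 (failInd I S) ≤ 1 - I.card / N + 0 := by
  have h := hspread ∅
  simp only [Finset.empty_subset, Finset.filter_true, Finset.card_empty, pow_zero, one_mul] at h
  have h1 : (I.card : ℝ) / N ≤ 1 := (div_le_one hN).2 h
  rcases I.eq_empty_or_nonempty with rfl | ⟨i, hi⟩
  · calc _ ≤ EE Finset.univ 0 (fun _ : Finset α => (1:ℝ)) := by
          refine EE_mono _ le_rfl zero_le_one fun W => ?_
          unfold failInd; split_ifs <;> norm_num
      _ = 1 := EE_one _ _ _
      _ ≤ _ := by simp
  · calc _ ≤ EE Finset.univ 0 (fun _ : Finset α => (0:ℝ)) := by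
          refine EE_mono _ le_rfl zero_le_one fun W => ?_
          unfold failInd
          rw [if_pos]
          exact ⟨i, hi, by rw [Finset.card_eq_zero.1 (Nat.le_zero.1 (hS i hi))]; simp⟩
      _ = 0 := EE_one _ _ _
      _ ≤ _ := by linarith

/-- total density after `j` rounds of density `δ` and a final round of density `δ'` -/
noncomputable def dens (δ δ' : ℝ) : ℕ → ℝ
  | 0 => 1 - (1 - δ') * (1 - 0)
  | j + 1 => 1 - (1 - δ) * (1 - dens δ δ' j)

lemma dens_bd (δ δ' : ℝ) (h0 : 0 ≤ δ) (h1 : δ ≤ 1) (h0' : 0 ≤ δ') (h1' : δ' ≤ 1) (j : ℕ) :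
    0 ≤ dens δ δ' j ∧ dens δ δ' j ≤ 1 ∧ dens δ δ' j ≤ j * δ + δ' := by
  induction j with
  | zero => simp [dens]; exact ⟨h0', h1'⟩
  | succ j ih =>
    obtain ⟨a, b, c⟩ := ih
    simp only [dens]; push_cast
    refine ⟨?_, ?_, ?_⟩ <;> nlinarith

lemma fail_rounds {α ι : Type*} [Fintype α] [DecidableEq α]
    (N q δ δ' : ℝ) (k : ℕ) (hk : 1 ≤ k)
    (hN : 0 < N) (hδ0 : 0 < δ) (hδ1 : δ ≤ 1) (hδ0' : 0 < δ') (hδ1' : δ' ≤ 1) (hq : 0 ≤ q)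
    (hqδ : q / δ ≤ 1 / 9) (j : ℕ) :
    ∀ (I : Finset ι) (S : ι → Finset α), (∀ i ∈ I, (S i).card ≤ k * 2 ^ j) →
    (∀ U : Finset α, (((I.filter fun i => U ⊆ S i).card : ℕ) : ℝ) ≤ q ^ U.card * N) →
    EE Finset.univ (dens δ δ' j) (failInd I S) ≤
      1 - I.card / N + (j * (4 / 9) ^ k + ((1 + q / δ') ^ k - 1)) := by
  induction j with
  | zero =>
    intro I S hS hspread
    have := fail_step I S N q δ' ((1 + q / δ') ^ k - 1) 0 0 k 0 hN hδ0' hδ1' hq le_rfl zero_le_one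
      (by simpa using hS) hspread (by
        intro A hA
        have hy : 0 ≤ q / δ' := by positivity
        have h1 : ∑ C ∈ A.powerset, (q / δ') ^ C.card = (1 + q / δ') ^ A.card := by
          have := Finset.sum_pow_mul_eq_add_pow (q / δ') 1 A
          simp only [one_pow, mul_one] at this
          rw [this, add_comm]
        have h2 : A.powerset.filter (fun C => 0 < C.card) = A.powerset.erase ∅ := by
          ext C; simp [Finset.card_pos, Finset.nonempty_iff_ne_empty, and_comm]
        have h3 := Finset.add_sum_erase A.powerset (fun C => (q / δ') ^ C.card)
          (Finset.empty_mem_powerset A)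
        simp only [Finset.card_empty, pow_zero] at h3
        rw [h2]
        have h4 : (1 + q / δ') ^ A.card ≤ (1 + q / δ') ^ k :=
          pow_le_pow_right₀ (by linarith) hA
        linarith) (fun J S' h h' => fail_base J S' N q hN h h')
    simpa [dens] using this
  | succ j ih =>
    intro I S hS hspread
    obtain ⟨a, b, c⟩ := dens_bd δ δ' hδ0.le hδ1 hδ0'.le hδ1' j
    have := fail_step I S N q δ ((4 / 9) ^ k) (dens δ δ' j) _ (k * 2 ^ (j + 1)) (k * 2 ^ j)
      hN hδ0 hδ1 hq a b hS hspread (by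
        intro A hA
        have hy : 0 ≤ q / δ := by positivity
        have h1 : ∀ C ∈ A.powerset.filter (fun C => k * 2 ^ j < C.card),
            (q / δ) ^ C.card ≤ (1 / 9 : ℝ) ^ (k * 2 ^ j) := by
          intro C hC
          have hC := (Finset.mem_filter.1 hC).2
          calc (q / δ) ^ C.card ≤ (1 / 9 : ℝ) ^ C.card := pow_le_pow_left₀ hy hqδ _
            _ ≤ _ := pow_le_pow_of_le_one (by norm_num) (by norm_num) hC.le
        calc _ ≤ ((A.powerset.filter (fun C => k * 2 ^ j < C.card)).card : ℝ) *
              (1 / 9 : ℝ) ^ (k * 2 ^ j) := by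
              rw [← nsmul_eq_mul]; exact Finset.sum_le_card_nsmul _ _ _ h1
          _ ≤ (2 : ℝ) ^ (k * 2 ^ (j + 1)) * (1 / 9 : ℝ) ^ (k * 2 ^ j) := by
              gcongr
              calc ((A.powerset.filter (fun C => k * 2 ^ j < C.card)).card : ℝ)
                  ≤ (A.powerset.card : ℝ) := by exact_mod_cast Finset.card_filter_le _ _
                _ = 2 ^ A.card := by rw [Finset.card_powerset]; push_cast; rfl
                _ ≤ _ := pow_le_pow_right₀ (by norm_num) hA
          _ = (4 / 9 : ℝ) ^ (k * 2 ^ j) := by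
              rw [pow_succ, ← mul_assoc, mul_comm _ 2, pow_mul, ← mul_pow]; norm_num
          _ ≤ _ := pow_le_pow_of_le_one (by norm_num) (by norm_num)
              (Nat.le_mul_of_pos_right _ (by positivity))) ih
    simp only [dens]
    refine this.trans (le_of_eq ?_)
    push_cast; ring

lemma tree_rank {V : Type*} {G : SimpleGraph V} (hG : G.IsTree) :
    ∃ r : V → ℕ, ∀ v u w, G.Adj v u → G.Adj v w → r u ≤ r v → r w ≤ r v → u = w := by
  obtain ⟨x⟩ := hG.connected.nonempty
  refine ⟨fun v => G.dist x v, fun v => ?_⟩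
  obtain ⟨p, hp, hp'⟩ := (hG.connected x v).exists_path_of_dist
  have key : ∀ w, G.Adj v w → G.dist x w ≤ G.dist x v → w = p.penultimate := by
    intro w hadj hle
    refine hG.isAcyclic.eq_penultimate_of_adj_end hp hadj ?_
    by_contra hw
    obtain ⟨q, hq, hq'⟩ := (hG.connected x w).exists_path_of_dist
    have hv : v ∈ q.support :=
      hG.isAcyclic.mem_support_of_ne_mem_support_of_adj_of_isPath hq hp hadj.symm hw
    have := hG.isAcyclic.path_concat hp hq hadj hv
    rw [this, p.length_concat] at hq'
    omega
  intro u w h1 h2 h3 h4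
  rw [key u h1 h3, key w h2 h4]

lemma swap_sum {V : Type*} [Fintype V] [DecidableEq V] (H : Finset (Equiv.Perm V))
    (B : Finset V) (x : V) (g : Equiv.Perm V → V → ℕ)
    (hH : ∀ w ∈ B, ∀ τ ∈ H, τ * Equiv.swap x w ∈ H)
    (hg : ∀ w ∈ B, ∀ τ ∈ H, ∀ y, g (τ * Equiv.swap x w) y = g τ y) :
    B.card * ∑ τ ∈ H, g τ (τ x) = ∑ τ ∈ H, ∑ w ∈ B, g τ (τ w) := by
  rw [Finset.sum_comm, ← smul_eq_mul, ← Finset.sum_const]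
  refine Finset.sum_congr rfl fun w hw => ?_
  refine Finset.sum_nbij' (fun τ => τ * Equiv.swap x w) (fun τ => τ * Equiv.swap x w)
    (fun τ hτ => hH w hw τ hτ) (fun τ hτ => hH w hw τ hτ) ?_ ?_ ?_
  · intro τ _; simp [mul_assoc]
  · intro τ _; simp [mul_assoc]
  · intro τ hτ
    rw [hg w hw τ hτ]; simp

open Classical in
/-- permutations mapping all edges of `U` to edges of `G` -/
noncomputable def homs {V : Type*} [Fintype V] (G : SimpleGraph V) (U : Finset (Sym2 V)) :
    Finset (Equiv.Perm V) :=
  Finset.univ.filter fun τ => ∀ e ∈ U, Sym2.map τ e ∈ G.edgeSet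

open Classical in
/-- vertices covered by `U` -/
noncomputable def vts {V : Type*} [Fintype V] (U : Finset (Sym2 V)) : Finset V :=
  Finset.univ.filter fun v => ∃ e ∈ U, v ∈ e

lemma homs_swap {V : Type*} [Fintype V] [DecidableEq V] (G : SimpleGraph V)
    (U : Finset (Sym2 V)) (x w : V) (hx : x ∉ vts U) (hw : w ∉ vts U) (τ : Equiv.Perm V)
    (hτ : τ ∈ homs G U) : τ * Equiv.swap x w ∈ homs G U := by
  simp only [homs, vts, Finset.mem_filter, Finset.mem_univ, true_and, not_exists, not_and] at *
  intro e he
  have : Sym2.map (τ * Equiv.swap x w) e = Sym2.map τ e := by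
    refine Sym2.map_congr fun y hy => ?_
    have h1 : y ≠ x := fun h => hx e he (h ▸ hy)
    have h2 : y ≠ w := fun h => hw e he (h ▸ hy)
    simp [Equiv.swap_apply_of_ne_of_ne h1 h2]
  rw [this]; exact hτ e he

open Classical in
lemma homs_count {V : Type*} [Fintype V] (G : SimpleGraph V) (D : ℕ)
    (h1 : ∀ a, (Finset.univ.filter fun b => G.Adj a b).card ≤ D)
    (h2 : ∑ a, (Finset.univ.filter fun b => G.Adj a b).card ≤ 2 * Fintype.card V)
    (r : V → ℕ) (h3 : ∀ v u w, G.Adj v u → G.Adj v w → r u ≤ r v → r w ≤ r v → u = w)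
    (s : ℕ) : ∀ U : Finset (Sym2 V), U.card = s → (homs G U).Nonempty →
      ∃ c ≤ s, (vts U).card = s + c ∧
        (homs G U).card * (Fintype.card V).descFactorial (s + c) ≤
          (Fintype.card V).factorial * (2 * Fintype.card V) ^ c * D ^ (s - c) := by
  set n := Fintype.card V with hn
  induction s with
  | zero =>
    intro U hU _
    rw [Finset.card_eq_zero] at hU
    subst hU
    refine ⟨0, le_rfl, by simp [vts], ?_⟩
    simp only [Nat.descFactorial_zero, mul_one, pow_zero, add_zero]
    refine (Finset.card_le_univ _).trans ?_
    rw [Fintype.card_perm]; simp [hn]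
  | succ s ih =>
    rintro U hU ⟨τ₀, hτ₀⟩
    have hτ₀' : ∀ e ∈ U, Sym2.map τ₀ e ∈ G.edgeSet := by simpa [homs] using hτ₀
    have hne : U.Nonempty := Finset.card_pos.1 (by omega)
    have hvne : (vts U).Nonempty := by
      obtain ⟨e, he⟩ := hne
      induction e with
      | _ a b => exact ⟨a, by simp only [vts, Finset.mem_filter, Finset.mem_univ, true_and]
                              exact ⟨_, he, by simp⟩⟩
    obtain ⟨v, hv, hmax⟩ := Finset.exists_max_image (vts U) (fun v => r (τ₀ v)) hvne
    have hv' := hv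
    simp only [vts, Finset.mem_filter, Finset.mem_univ, true_and] at hv'
    obtain ⟨e₀, he₀, hve₀⟩ := hv'
    obtain ⟨u, rfl⟩ := Sym2.mem_iff_exists.1 hve₀
    have hadj : G.Adj (τ₀ v) (τ₀ u) := by simpa using hτ₀' _ he₀
    have huv : u ≠ v := by rintro rfl; exact G.loopless.irrefl _ hadj
    have hmem : ∀ a b, s(a, b) ∈ U → b ∈ vts U := fun a b h => by
      simp only [vts, Finset.mem_filter, Finset.mem_univ, true_and]
      exact ⟨_, h, by simp⟩
    have huniq : ∀ w, s(v, w) ∈ U → w = u := by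
      intro w hw
      have hadj' : G.Adj (τ₀ v) (τ₀ w) := by simpa using hτ₀' _ hw
      exact τ₀.injective (h3 _ _ _ hadj' hadj (hmax w (hmem _ _ hw)) (hmax u (hmem _ _ he₀)))
    set U' := U.erase s(v, u) with hU'
    have hcard : U'.card = s := by rw [Finset.card_erase_of_mem he₀, hU]; rfl
    have hUU : ∀ e, e ∈ U ↔ e = s(v, u) ∨ e ∈ U' := by
      intro e
      simp only [hU', Finset.mem_erase]
      constructor
      · intro h; by_cases h' : e = s(v, u) <;> simp [h, h']
      · rintro (rfl | h); exacts [he₀, h.2]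
    have hhoms : ∀ τ, τ ∈ homs G U ↔ τ ∈ homs G U' ∧ G.Adj (τ u) (τ v) := by
      intro τ
      simp only [homs, Finset.mem_filter, Finset.mem_univ, true_and, hUU]
      constructor
      · intro h
        refine ⟨fun e he => h e (Or.inr he), ?_⟩
        have := h _ (Or.inl rfl)
        rw [Sym2.map_mk, SimpleGraph.mem_edgeSet] at this
        exact this.symm
      · rintro ⟨h, h'⟩ e (rfl | he)
        · rw [Sym2.map_mk, SimpleGraph.mem_edgeSet]; exact h'.symm
        · exact h e he
    obtain ⟨c, hc, hcv, hcount⟩ := ih U' hcard ⟨τ₀, ((hhoms τ₀).1 hτ₀).1⟩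
    have hvU' : v ∉ vts U' := by
      simp only [vts, Finset.mem_filter, Finset.mem_univ, true_and, not_exists, not_and]
      intro e he hve
      obtain ⟨w, rfl⟩ := Sym2.mem_iff_exists.1 hve
      have := huniq w ((hUU _).2 (Or.inr he))
      subst this
      simp [hU'] at he
    have hvts : vts U = insert v (insert u (vts U')) := by
      ext y
      simp only [vts, Finset.mem_insert, Finset.mem_filter, Finset.mem_univ, true_and, hUU]
      constructor
      · rintro ⟨e, rfl | he, hy⟩
        · rcases Sym2.mem_iff.1 hy with h | h <;> simp [h]
        · exact Or.inr (Or.inr ⟨e, he, hy⟩)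
      · rintro (rfl | rfl | ⟨e, he, hy⟩)
        · exact ⟨_, Or.inl rfl, by simp⟩
        · exact ⟨_, Or.inl rfl, by simp⟩
        · exact ⟨e, Or.inr he, hy⟩
    have hsum : (homs G U).card = ∑ τ ∈ homs G U', if G.Adj (τ u) (τ v) then 1 else 0 := by
      rw [← Finset.card_filter]
      congr 1
      ext τ; rw [hhoms, Finset.mem_filter]
    have hdeg : ∀ (B : Finset V) (τ : Equiv.Perm V) (a : V),
        (∑ w ∈ B, if G.Adj a (τ w) then 1 else 0) ≤
          (Finset.univ.filter fun b => G.Adj a b).card := by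
      intro B τ a
      rw [← Finset.card_filter]
      refine Finset.card_le_card_of_injOn τ ?_ τ.injective.injOn
      intro w hw
      simp only [Finset.coe_filter, Set.mem_ofPred_eq] at hw
      simp [hw.2]
    set A := vts U' with hA
    by_cases hu : u ∈ A
    · have hvts' : (vts U).card = s + c + 1 := by
        rw [hvts, Finset.insert_eq_of_mem hu, Finset.card_insert_of_notMem hvU', hcv]
      refine ⟨c, by omega, by omega, ?_⟩
      have hsw := swap_sum (homs G U') Aᶜ v (fun τ y => if G.Adj (τ u) y then 1 else 0)
        (fun w hw τ hτ => homs_swap G U' v w hvU' (Finset.mem_compl.1 hw) τ hτ)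
        (fun w hw τ hτ y => by
          have h2 : u ≠ w := fun h => Finset.mem_compl.1 hw (h ▸ hu)
          simp [Equiv.swap_apply_of_ne_of_ne huv h2])
      rw [← hsum, Finset.card_compl, hcv] at hsw
      have hle : (n - (s + c)) * (homs G U).card ≤ (homs G U').card * D := by
        rw [hsw]
        calc _ ≤ ∑ τ ∈ homs G U', D := Finset.sum_le_sum fun τ _ => (hdeg _ _ _).trans (h1 _)
          _ = _ := by simp
      have e1 : s + 1 + c = (s + c) + 1 := by ring
      have e2 : s + 1 - c = (s - c) + 1 := by omega
      rw [e1, e2, Nat.descFactorial_succ, pow_succ]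
      calc (homs G U).card * ((n - (s + c)) * n.descFactorial (s + c))
          = ((n - (s + c)) * (homs G U).card) * n.descFactorial (s + c) := by ring
        _ ≤ ((homs G U').card * D) * n.descFactorial (s + c) := Nat.mul_le_mul_right _ hle
        _ = ((homs G U').card * n.descFactorial (s + c)) * D := by ring
        _ ≤ (n.factorial * (2 * n) ^ c * D ^ (s - c)) * D := Nat.mul_le_mul_right _ hcount
        _ = _ := by ring
    · have hvts' : (vts U).card = s + c + 2 := by
        rw [hvts, Finset.card_insert_of_notMem, Finset.card_insert_of_notMem hu, hcv]
        simp [huv.symm, hvU']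
      refine ⟨c + 1, by omega, by omega, ?_⟩
      have hsw1 := swap_sum (homs G U') Aᶜ u
        (fun τ y => (Finset.univ.filter fun b => G.Adj y b).card)
        (fun w hw τ hτ => homs_swap G U' u w hu (Finset.mem_compl.1 hw) τ hτ)
        (fun w hw τ hτ y => rfl)
      have hsw2 := swap_sum (homs G U') (insert u A)ᶜ v (fun τ y => if G.Adj (τ u) y then 1 else 0)
        (fun w hw τ hτ => homs_swap G U' v w hvU'
          (fun h => Finset.mem_compl.1 hw (Finset.mem_insert_of_mem h)) τ hτ)
        (fun w hw τ hτ y => by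
          have h2 : u ≠ w := fun h => Finset.mem_compl.1 hw (h ▸ Finset.mem_insert_self _ _)
          simp [Equiv.swap_apply_of_ne_of_ne huv h2])
      rw [Finset.card_compl, hcv] at hsw1
      rw [← hsum, Finset.card_compl, Finset.card_insert_of_notMem hu, hcv] at hsw2
      have hle1 : (n - (s + c)) * ∑ τ ∈ homs G U', (Finset.univ.filter fun b => G.Adj (τ u) b).card
          ≤ (homs G U').card * (2 * n) := by
        rw [hsw1]
        calc _ ≤ ∑ τ ∈ homs G U', (2 * n) := by
              refine Finset.sum_le_sum fun τ _ => ?_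
              refine le_trans (Finset.sum_le_sum_of_subset (Finset.subset_univ _)) ?_
              rw [Equiv.sum_comp τ (fun y => (Finset.univ.filter fun b => G.Adj y b).card)]
              exact h2
          _ = _ := by simp
      have hle2 : (n - (s + c + 1)) * (homs G U).card ≤
          ∑ τ ∈ homs G U', (Finset.univ.filter fun b => G.Adj (τ u) b).card := by
        rw [hsw2]
        exact Finset.sum_le_sum fun τ _ => hdeg _ _ _
      have e1 : s + 1 + (c + 1) = (s + c + 1) + 1 := by ring
      have e2 : s + 1 - (c + 1) = s - c := by omega
      rw [e1, e2, Nat.descFactorial_succ, Nat.descFactorial_succ, pow_succ]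
      calc (homs G U).card * ((n - (s + c + 1)) * ((n - (s + c)) * n.descFactorial (s + c)))
          = ((n - (s + c)) * ((n - (s + c + 1)) * (homs G U).card)) *
              n.descFactorial (s + c) := by ring
        _ ≤ ((homs G U').card * (2 * n)) * n.descFactorial (s + c) :=
            Nat.mul_le_mul_right _ ((Nat.mul_le_mul_left _ hle2).trans hle1)
        _ = ((homs G U').card * n.descFactorial (s + c)) * (2 * n) := by ring
        _ ≤ (n.factorial * (2 * n) ^ c * D ^ (s - c)) * (2 * n) := Nat.mul_le_mul_right _ hcount
        _ = _ := by ring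

lemma pow_le_exp_descFactorial (n : ℕ) : ∀ v ≤ n,
    (n : ℝ) ^ v ≤ Real.exp 1 ^ v * (n.descFactorial v : ℝ) := by
  induction n with
  | zero => intro v hv; obtain rfl : v = 0 := by omega
            simp
  | succ n ih =>
    intro v hv
    rcases v with _ | v
    · simp
    have hv' : v ≤ n := by omega
    have h := ih v hv'
    rw [Nat.succ_descFactorial_succ]
    push_cast
    have h1 : ((n : ℝ) + 1) ^ v ≤ Real.exp 1 * (n : ℝ) ^ v := by
      rcases Nat.eq_zero_or_pos n with rfl | hn
      · obtain rfl : v = 0 := by omega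
        simp
      have hn' : (0 : ℝ) < n := by exact_mod_cast hn
      have h2 : ((n : ℝ) + 1) = (1 + 1 / n) * n := by field_simp
      rw [h2, mul_pow]
      gcongr
      calc (1 + 1 / (n : ℝ)) ^ v ≤ (Real.exp (1 / n)) ^ v := by
            gcongr; rw [add_comm]; exact Real.add_one_le_exp _
        _ = Real.exp (v * (1 / n)) := by rw [← Real.exp_nat_mul]
        _ ≤ Real.exp 1 := by
            apply Real.exp_le_exp.2
            rw [mul_one_div, div_le_one hn']
            exact_mod_cast hv'
    calc ((n : ℝ) + 1) ^ (v + 1) = (n + 1) * (n + 1) ^ v := by ring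
      _ ≤ (n + 1) * (Real.exp 1 * (n : ℝ) ^ v) := by gcongr
      _ ≤ (n + 1) * (Real.exp 1 * (Real.exp 1 ^ v * (n.descFactorial v : ℝ))) := by gcongr
      _ = _ := by ring

open Classical in
lemma homs_spread {V : Type*} [Fintype V] [Nonempty V] (G : SimpleGraph V) (D : ℕ) (hD : 6 ≤ D)
    (h1 : ∀ a, (Finset.univ.filter fun b => G.Adj a b).card ≤ D)
    (h2 : ∑ a, (Finset.univ.filter fun b => G.Adj a b).card ≤ 2 * Fintype.card V)
    (r : V → ℕ) (h3 : ∀ v u w, G.Adj v u → G.Adj v w → r u ≤ r v → r w ≤ r v → u = w)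
    (U : Finset (Sym2 V)) :
    ((homs G U).card : ℝ) ≤ (Real.exp 1 * D / Fintype.card V) ^ U.card *
      ((Fintype.card V).factorial : ℝ) := by
  rcases (homs G U).eq_empty_or_nonempty with h | h
  · rw [h]; simp; positivity
  obtain ⟨c, hc, hcv, hcount⟩ := homs_count G D h1 h2 r h3 _ U rfl h
  set s := U.card
  set n := Fintype.card V with hn
  have hn0 : (0 : ℝ) < n := by exact_mod_cast Fintype.card_pos
  have hpow := pow_le_exp_descFactorial n (s + c) (hcv ▸ Finset.card_le_univ _)
  have hcount' : ((homs G U).card : ℝ) * (n.descFactorial (s + c) : ℝ) ≤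
      n.factorial * (2 * n) ^ c * D ^ (s - c) := by exact_mod_cast hcount
  have he : 2 * Real.exp 1 ≤ D := by
    have h6 : (6 : ℝ) ≤ D := by exact_mod_cast hD
    have := Real.exp_one_lt_d9
    linarith
  have key : ((homs G U).card : ℝ) * n ^ (s + c) ≤
      ((Real.exp 1 * D / n) ^ s * n.factorial) * n ^ (s + c) := by
    calc ((homs G U).card : ℝ) * n ^ (s + c)
        ≤ (homs G U).card * (Real.exp 1 ^ (s + c) * (n.descFactorial (s + c) : ℝ)) := by gcongr
      _ = Real.exp 1 ^ (s + c) * ((homs G U).card * (n.descFactorial (s + c) : ℝ)) := by ring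
      _ ≤ Real.exp 1 ^ (s + c) * (n.factorial * (2 * n) ^ c * D ^ (s - c)) := by gcongr
      _ = Real.exp 1 ^ s * n.factorial * n ^ c * D ^ (s - c) * (2 * Real.exp 1) ^ c := by
          rw [pow_add, mul_pow, mul_pow]; ring
      _ ≤ Real.exp 1 ^ s * n.factorial * n ^ c * D ^ (s - c) * D ^ c := by gcongr
      _ = Real.exp 1 ^ s * n.factorial * n ^ c * (D ^ (s - c) * D ^ c) := by ring
      _ = Real.exp 1 ^ s * n.factorial * n ^ c * D ^ s := by rw [← pow_add, Nat.sub_add_cancel hc]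
      _ = _ := by rw [pow_add, div_pow, mul_pow]; field_simp
  exact le_of_mul_le_mul_right key (by positivity)

lemma gnp_bridge {n : ℕ} {p : ℝ} (h0 : 0 ≤ p) (h1 : p ≤ 1)
    (C : Set (Sym2 (Fin n) → Bool)) (f : Finset (Sym2 (Fin n)) → ℝ) (hf0 : ∀ W, 0 ≤ f W)
    (hf : ∀ ω, ω ∉ C → 1 ≤ f (Finset.univ.filter fun e => ω e = true)) :
    gnp n p C ≤ 1 ∧ ENNReal.ofReal (1 - EE Finset.univ p f) ≤ gnp n p C := by
  classical
  have hmin : min (ENNReal.ofReal p) 1 = ENNReal.ofReal p :=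
    min_eq_left (ENNReal.ofReal_le_one.2 h1)
  have hb : IsProbabilityMeasure (bernoulliMeasure p) := by
    constructor
    simp only [bernoulliMeasure, hmin, Measure.coe_add, Measure.coe_smul, Pi.add_apply,
      Pi.smul_apply, measure_univ, smul_eq_mul, mul_one]
    exact add_tsub_cancel_of_le (ENNReal.ofReal_le_one.2 h1)
  have hb1 : bernoulliMeasure p {true} = ENNReal.ofReal p := by
    simp [bernoulliMeasure, hmin]
  have hb2 : bernoulliMeasure p {false} = ENNReal.ofReal (1 - p) := by
    simp [bernoulliMeasure, hmin, ENNReal.ofReal_sub _ h0]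
  have hprob : IsProbabilityMeasure (gnp n p) := by unfold gnp; infer_instance
  refine ⟨prob_le_one, ?_⟩
  have hp' : 0 ≤ 1 - p := by linarith
  have hsing : ∀ ω : Sym2 (Fin n) → Bool, (gnp n p).real {ω} =
      p ^ (Finset.univ.filter fun e => ω e = true).card *
      (1 - p) ^ (Finset.univ \ (Finset.univ.filter fun e => ω e = true)).card := by
    intro ω
    have hb3 : ∀ b : Bool, (bernoulliMeasure p {b}).toReal = if b = true then p else 1 - p := by
      intro b; cases b
      · simp [hb2, hp']
      · simp [hb1, h0]
    rw [measureReal_def, gnp, Measure.pi_singleton, ENNReal.toReal_prod]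
    simp only [hb3]
    rw [Finset.prod_ite, Finset.prod_const, Finset.prod_const]
    congr 3
    ext e; simp
  have hsum : (gnp n p).real Cᶜ ≤ EE Finset.univ p f := by
    have e1 : (gnp n p).real Cᶜ = ∑ ω ∈ Finset.univ.filter (fun ω => ω ∈ Cᶜ), (gnp n p).real {ω} := by
      rw [sum_measureReal_singleton]; congr 1; ext; simp
    rw [e1, Finset.sum_filter]
    unfold EE
    rw [Finset.powerset_univ]
    let g : (Sym2 (Fin n) → Bool) ≃ Finset (Sym2 (Fin n)) :=
      { toFun := fun ω => Finset.univ.filter fun e => ω e = true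
        invFun := fun W e => decide (e ∈ W)
        left_inv := fun ω => by ext e; simp
        right_inv := fun W => by ext e; simp }
    rw [← Equiv.sum_comp g]
    refine Finset.sum_le_sum fun ω _ => ?_
    have hg : g ω = Finset.univ.filter fun e => ω e = true := rfl
    rw [hg]
    split_ifs with h
    · rw [hsing]
      exact le_mul_of_one_le_right (by positivity) (hf ω h)
    · exact mul_nonneg (by positivity) (hf0 _)
  have hC : (gnp n p).real C = 1 - (gnp n p).real Cᶜ := by
    have := probReal_compl_eq_one_sub (μ := gnp n p) (s := C) (MeasurableSet.of_discrete)
    linarith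
  rw [ENNReal.ofReal_le_iff_le_toReal (measure_ne_top _ _)]
  change _ ≤ (gnp n p).real C
  linarith

open Classical in
/-- preimage of the edge set of `G` under `τ` -/
noncomputable def Sfam {V : Type*} [Fintype V] (G : SimpleGraph V) (τ : Equiv.Perm V) :
    Finset (Sym2 V) := Finset.univ.filter fun e => Sym2.map τ e ∈ G.edgeSet

open Classical in
lemma main_finite {n m : ℕ} (hn : 1 ≤ n) (hm : m ≤ n) (T : SimpleGraph (Fin m)) (hT : T.IsTree)
    (D : ℕ) (hD : 6 ≤ D) (hTD : maxDeg T ≤ D) (k R : ℕ) (hk : n ≤ k * 2 ^ R) 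
    (L p : ℝ) (hL : 1 ≤ L) (hp1 : p ≤ 1) (hR : 1 ≤ R)
    (hp : R * (9 * (Real.exp 1 * D / n)) + L * (Real.exp 1 * D / n) ≤ p) :
    gnp n p {ω | ContainsCopy T (graphOf ω)} ≤ 1 ∧ 
    ENNReal.ofReal (1 - (R * (4 / 9 : ℝ) ^ k + ((1 + 1 / L) ^ k - 1))) ≤ 
      gnp n p {ω | ContainsCopy T (graphOf ω)} := by
  set q := Real.exp 1 * D / n with hq
  have hn0 : (0 : ℝ) < n := by exact_mod_cast hn
  have hD0 : (0 : ℝ) < D := by exact_mod_cast (by omega : 0 < D)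
  have hq0 : 0 < q := by positivity
  have hR' : (1 : ℝ) ≤ R := by exact_mod_cast hR
  have hd : 9 * q ≤ 1 := by nlinarith
  have hd' : L * q ≤ 1 := by nlinarith
  have hp0 : 0 ≤ p := le_trans (by positivity) hp
  have : Nonempty (Fin n) := ⟨⟨0, hn⟩⟩
  set ι : Fin m ↪ Fin n := Fin.castLEEmb hm with hι
  obtain ⟨G, hG⟩ : ∃ G, G = T.map ι := ⟨_, rfl⟩
  have hedge : G.edgeFinset.card ≤ n := by
    have h1 : G.edgeFinset.card = T.edgeFinset.card := by
      subst hG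
      convert SimpleGraph.card_edgeFinset_map ι T
    have h2 := hT.card_edgeFinset
    rw [Fintype.card_fin] at h2
    omega
  have h1 : ∀ a, (Finset.univ.filter fun b => G.Adj a b).card ≤ D := by
    intro a
    by_cases ha : ∃ u, ι u = a
    · obtain ⟨u, rfl⟩ := ha
      have h2 : (Finset.univ.filter fun b => G.Adj (ι u) b) ⊆
          (Finset.univ.filter fun w => T.Adj u w).image ι := by
        intro b hb
        simp only [Finset.mem_filter, Finset.mem_univ, true_and, hG, SimpleGraph.map_adj] at hb
        obtain ⟨u', w, h, h', rfl⟩ := hb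
        rw [ι.injective h'] at h
        exact Finset.mem_image_of_mem _ (by simp [h])
      refine (Finset.card_le_card h2).trans (Finset.card_image_le.trans (le_trans ?_ hTD))
      have h3 : (T.neighborSet u).ncard ≤ maxDeg T :=
        Finset.le_sup (f := fun v => (T.neighborSet v).ncard) (Finset.mem_univ u)
      refine le_trans (le_of_eq ?_) h3
      rw [← Set.ncard_coe_finset]
      congr 1; ext w; simp
    · have : (Finset.univ.filter fun b => G.Adj a b) = ∅ := by
        ext b
        simp only [Finset.mem_filter, Finset.mem_univ, true_and, hG, SimpleGraph.map_adj,
          Finset.notMem_empty, iff_false]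
        rintro ⟨u', w, h, h', rfl⟩
        exact ha ⟨u', h'⟩
      rw [this]; simp
  have h2 : ∑ a, (Finset.univ.filter fun b => G.Adj a b).card ≤ 2 * Fintype.card (Fin n) := by
    have := G.sum_degrees_eq_twice_card_edges
    have e : ∀ a, G.degree a = (Finset.univ.filter fun b => G.Adj a b).card := by
      intro a
      rw [← SimpleGraph.card_neighborFinset_eq_degree, SimpleGraph.neighborFinset_eq_filter]
    simp only [e] at this
    rw [this, Fintype.card_fin]
    omega
  obtain ⟨r, hr⟩ := tree_rank hT
  have h3 : ∀ v u w, G.Adj v u → G.Adj v w → (Function.extend ι r 0) u ≤ (Function.extend ι r 0) v →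
      (Function.extend ι r 0) w ≤ (Function.extend ι r 0) v → u = w := by
    intro v u w hu hw
    rw [hG, SimpleGraph.map_adj] at hu hw
    obtain ⟨v1, u1, a1, rfl, rfl⟩ := hu
    obtain ⟨v2, w2, a2, b2, rfl⟩ := hw
    rw [ι.injective b2] at a2
    simp only [ι.injective.extend_apply]
    intro c1 c2
    rw [hr _ _ _ a1 a2 c1 c2]
  have hspread := homs_spread G D hD h1 h2 _ h3
  simp only [Fintype.card_fin] at hspread
  have hfail := fail_rounds (ι := Equiv.Perm (Fin n)) (α := Sym2 (Fin n)) (n.factorial : ℝ) q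
    (9 * q) (L * q) k (by
      by_contra h
      obtain rfl : k = 0 := by omega
      simp at hk; omega) (by positivity) (by positivity) hd (by positivity) hd' hq0.le
    (by rw [div_le_iff₀ (by positivity)]; linarith) R Finset.univ (Sfam G) (by
      intro τ _
      refine le_trans ?_ hk
      refine le_trans ?_ hedge
      refine Finset.card_le_card_of_injOn (Sym2.map τ) ?_ (Sym2.map.injective τ.injective).injOn
      intro e he
      simpa [Sfam] using he) (by
      intro U
      refine le_trans (le_of_eq ?_) (hspread U)
      congr 2
      ext τ
      simp only [homs, Sfam, Finset.mem_filter, Finset.mem_univ, true_and, Finset.subset_iff])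
  have hNN : ((Finset.univ : Finset (Equiv.Perm (Fin n))).card : ℝ) / (n.factorial : ℝ) = 1 := by
    rw [Finset.card_univ, Fintype.card_perm, Fintype.card_fin]
    field_simp
  have hqL : q / (L * q) = 1 / L := by field_simp
  rw [hNN, hqL, sub_self, zero_add] at hfail
  obtain ⟨d0, d1, d2⟩ := dens_bd (9 * q) (L * q) (by positivity) hd (by positivity) hd' R
  have hanti := EE_anti Finset.univ d0 (d2.trans hp) hp1
    (f := failInd (Finset.univ : Finset (Equiv.Perm (Fin n))) (Sfam G)) (by
      intro W W'
      unfold failInd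
      split_ifs with a b b
      · exact le_rfl
      · norm_num
      · obtain ⟨i, hi, hiW⟩ := b
        exact absurd ⟨i, hi, hiW.trans Finset.subset_union_left⟩ a
      · exact le_rfl)
  obtain ⟨g1, g2⟩ := gnp_bridge hp0 hp1 {ω | ContainsCopy T (graphOf ω)}
    (failInd (Finset.univ : Finset (Equiv.Perm (Fin n))) (Sfam G))
    (by intro W; unfold failInd; split_ifs <;> norm_num) (by
      intro ω hω
      unfold failInd
      rw [if_neg]
      rintro ⟨τ, -, hτ⟩
      refine hω ⟨fun u => τ.symm (ι u), τ.symm.injective.comp ι.injective, fun u v huv => ?_⟩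
      have hmem : s(τ.symm (ι u), τ.symm (ι v)) ∈ Sfam G τ := by
        simp only [Sfam, Finset.mem_filter, Finset.mem_univ, true_and, Sym2.map_mk,
          Equiv.apply_symm_apply, SimpleGraph.mem_edgeSet, hG, SimpleGraph.map_adj]
        exact ⟨u, v, huv, rfl, rfl⟩
      have hω' := hτ hmem
      simp only [Finset.mem_filter, Finset.mem_univ, true_and] at hω'
      rw [graphOf, SimpleGraph.fromRel_adj]
      refine ⟨fun h => huv.ne (ι.injective (τ.symm.injective h)), Or.inl hω'⟩)
  refine ⟨g1, le_trans (ENNReal.ofReal_le_ofReal ?_) g2⟩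
  linarith

lemma err_tendsto : Tendsto (fun s : ℝ => 1 - ((2 * s ^ 2 + 1) * Real.exp (-(s / 2)) +
    (Real.exp ((s + 1) / s ^ 2) - 1))) atTop (𝓝 1) := by
  have hs : Tendsto (fun s : ℝ => s / 2) atTop atTop := tendsto_id.atTop_div_const (by norm_num)
  have h1 := (Real.tendsto_pow_mul_exp_neg_atTop_nhds_zero 2).comp hs
  have h2 := (Real.tendsto_pow_mul_exp_neg_atTop_nhds_zero 0).comp hs
  have hi : Tendsto (fun s : ℝ => s⁻¹) atTop (𝓝 0) := tendsto_inv_atTop_zero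
  have h3 : Tendsto (fun s : ℝ => s⁻¹ + s⁻¹ * s⁻¹) atTop (𝓝 (0 + 0 * 0)) := hi.add (hi.mul hi)
  have h4 := (Real.continuous_exp.tendsto _).comp h3
  have h5 := tendsto_const_nhds (x := (1 : ℝ)) (f := (atTop : Filter ℝ)) |>.sub
    (((h1.const_mul 8).add h2).add (h4.sub_const 1))
  simp only [mul_zero, add_zero, Real.exp_zero, sub_self, sub_zero] at h5
  refine h5.congr' ?_
  filter_upwards [eventually_gt_atTop 0] with s hs0
  simp only [Function.comp]
  have : (s + 1) / s ^ 2 = s⁻¹ + s⁻¹ * s⁻¹ := by field_simp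
  rw [this]; ring

lemma clog_bd (n : ℕ) (hn : 2 ≤ n) : ((Nat.clog 2 n : ℕ) : ℝ) * 0.6931 ≤ Real.log n + 0.6931 ∧
    1 ≤ Nat.clog 2 n := by
  have hpos : 0 < Nat.clog 2 n := Nat.clog_pos (by norm_num) hn
  refine ⟨?_, hpos⟩
  have h := Nat.pow_pred_clog_lt_self (b := 2) (by norm_num) (x := n) (by omega)
  obtain ⟨j, hj⟩ : ∃ j, Nat.clog 2 n = j + 1 := ⟨_, (Nat.succ_pred_eq_of_pos hpos).symm⟩
  rw [hj] at h ⊢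
  simp only [Nat.pred_succ] at h
  have h' : (2 : ℝ) ^ j ≤ n := by exact_mod_cast h.le
  have h2 := Real.log_le_log (by positivity) h'
  rw [Real.log_pow] at h2
  have h3 := Real.log_two_gt_d9
  have h4 : (j : ℝ) * 0.6931 ≤ j * Real.log 2 := by
    apply mul_le_mul_of_nonneg_left _ (Nat.cast_nonneg j); linarith
  push_cast; linarith

/-- **Krivelevich's theorem on spanning trees.** For every `ε > 0` and every sequence `(T_n)`
of trees with `v(T_n) ≤ n`, if `p ≥ (40·Δ(T_n)·ε⁻¹·log n + n^ε)/n` then a.a.s. `G(n,p)`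
contains a copy of `T_n`. -/
theorem stmt_9 (ε : ℝ) (hε : 0 < ε) (m : ℕ → ℕ) (hm : ∀ n, m n ≤ n)
    (T : ∀ n : ℕ, SimpleGraph (Fin (m n))) (hT : ∀ᶠ n in atTop, (T n).IsTree)
    (p : ℕ → ℝ) (hp : ∀ n, 0 ≤ p n ∧ p n ≤ 1)
    (hpge : ∀ᶠ n : ℕ in atTop,
      (40 * (maxDeg (T n) : ℝ) * ε⁻¹ * Real.log n + (n : ℝ) ^ ε) / n ≤ p n) :
    Tendsto (fun n : ℕ => gnp n (p n) {ω | ContainsCopy (T n) (graphOf ω)}) atTop (𝓝 1) := by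
  have hlog : Tendsto (fun n : ℕ => Real.log n) atTop atTop :=
    Real.tendsto_log_atTop.comp tendsto_natCast_atTop_atTop
  have hsq : Tendsto (fun n : ℕ => √(Real.log n)) atTop atTop := Real.tendsto_sqrt_atTop.comp hlog
  have hlow := ENNReal.tendsto_ofReal (err_tendsto.comp hsq)
  rw [ENNReal.ofReal_one] at hlow
  have hbig : ∀ᶠ n : ℕ in atTop, 240 * Real.log n ≤ (n : ℝ) ^ ε := by
    have := (isLittleO_log_rpow_atTop hε).bound (c := 1 / 240) (by norm_num)
    have h2 := tendsto_natCast_atTop_atTop (R := ℝ) |>.eventually this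
    filter_upwards [h2] with n hn
    rw [Real.norm_eq_abs, Real.norm_eq_abs, abs_of_nonneg (a := (n : ℝ) ^ ε) (by positivity)] at hn
    have := le_abs_self (Real.log n)
    linarith
  have hall : ∀ᶠ n : ℕ in atTop,
      gnp n (p n) {ω | ContainsCopy (T n) (graphOf ω)} ≤ 1 ∧
      ENNReal.ofReal (1 - ((2 * √(Real.log n) ^ 2 + 1) * Real.exp (-(√(Real.log n) / 2)) +
        (Real.exp ((√(Real.log n) + 1) / √(Real.log n) ^ 2) - 1))) ≤
      gnp n (p n) {ω | ContainsCopy (T n) (graphOf ω)} := by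
    filter_upwards [hT, hpge, hbig, hlog.eventually_ge_atTop 20, eventually_ge_atTop 2]
      with n hTn hpn hbn hLn hn2
    set L := Real.log n with hL
    have hn0 : (0 : ℝ) < n := by exact_mod_cast (by omega : 0 < n)
    have hn1 : (1 : ℝ) < n := by exact_mod_cast (by omega : 1 < n)
    have hp1 := (hp n).2
    rw [div_le_iff₀ hn0] at hpn
    have hΔ0 : (0 : ℝ) ≤ maxDeg (T n) := Nat.cast_nonneg _
    have hε1 : ε ≤ 1 := by
      by_contra h
      push Not at h
      have h1 : (n : ℝ) < (n : ℝ) ^ ε := by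
        calc (n : ℝ) = (n : ℝ) ^ (1 : ℝ) := (Real.rpow_one _).symm
          _ < _ := Real.rpow_lt_rpow_of_exponent_lt hn1 h
      have h2 : 0 ≤ 40 * (maxDeg (T n) : ℝ) * ε⁻¹ * L := by
        have : 0 ≤ L := by linarith
        positivity
      nlinarith
    obtain ⟨D, hD6, hDT, hDp⟩ : ∃ D : ℕ, 6 ≤ D ∧ maxDeg (T n) ≤ D ∧ 40 * D * L ≤ p n * n := by
      by_cases h6 : 6 ≤ maxDeg (T n)
      · refine ⟨maxDeg (T n), h6, le_rfl, le_trans ?_ hpn⟩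
        have h1 : 1 ≤ ε⁻¹ := (one_le_inv₀ hε).2 hε1
        have h2 : 0 ≤ 40 * (maxDeg (T n) : ℝ) * L := by
          have : 0 ≤ L := by linarith
          positivity
        have h3 : 0 ≤ (n : ℝ) ^ ε := by positivity
        nlinarith
      · refine ⟨6, le_rfl, by omega, le_trans ?_ hpn⟩
        have h2 : 0 ≤ 40 * (maxDeg (T n) : ℝ) * ε⁻¹ * L := by
          have : 0 ≤ L := by linarith
          positivity
        push_cast; linarith
    have hD0 : (0 : ℝ) < D := by exact_mod_cast (by omega : 0 < D)
    set k := ⌊√L⌋₊ + 1 with hk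
    obtain ⟨hR, hR1⟩ := clog_bd n hn2
    set R := Nat.clog 2 n with hRdef
    have hkR : n ≤ k * 2 ^ R := by
      calc n ≤ 2 ^ R := Nat.le_pow_clog (by norm_num) n
        _ ≤ k * 2 ^ R := Nat.le_mul_of_pos_left _ (by omega)
    have hRL : (R : ℝ) ≤ 2 * L + 1 := by linarith
    have hdens : R * (9 * (Real.exp 1 * D / n)) + L * (Real.exp 1 * D / n) ≤ p n := by
      have he := Real.exp_one_lt_d9
      have h1 : R * (9 * (Real.exp 1 * D / n)) + L * (Real.exp 1 * D / n)
          = (9 * R + L) * Real.exp 1 * D / n := by ring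
      rw [h1, div_le_iff₀ hn0]
      refine le_trans ?_ hDp
      have hR0 : (0 : ℝ) ≤ R := Nat.cast_nonneg _
      have h2 : (9 * R + L) * Real.exp 1 ≤ (9 * R + L) * 2.7183 := by
        apply mul_le_mul_of_nonneg_left <;> linarith
      have h3 : (9 * R + L) * 2.7183 ≤ 40 * L := by linarith
      have := mul_le_mul_of_nonneg_right (h2.trans h3) hD0.le
      linarith
    obtain ⟨g1, g2⟩ := main_finite (by omega) (hm n) (T n) hTn D hD6 hDT k R hkR L (p n)
      (by linarith) hp1 hR1 hdens
    refine ⟨g1, le_trans (ENNReal.ofReal_le_ofReal ?_) g2⟩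
    have hs0 : 0 ≤ √L := Real.sqrt_nonneg _
    have hs2 : √L ^ 2 = L := Real.sq_sqrt (by linarith)
    have hk1 : √L ≤ k := by rw [hk]; push_cast; exact (Nat.lt_floor_add_one _).le
    have hk2 : (k : ℝ) ≤ √L + 1 := by
      rw [hk]; push_cast; linarith [Nat.floor_le hs0]
    have t1 : (4 / 9 : ℝ) ^ k ≤ Real.exp (-(√L / 2)) := by
      have : (4 / 9 : ℝ) ≤ Real.exp (-(1 / 2)) := by
        have := Real.add_one_le_exp (-(1 / 2 : ℝ)); linarith
      calc (4 / 9 : ℝ) ^ k ≤ Real.exp (-(1 / 2)) ^ k := by gcongr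
        _ = Real.exp (k * -(1 / 2)) := by rw [← Real.exp_nat_mul]
        _ ≤ _ := Real.exp_le_exp.2 (by linarith)
    have t2 : (1 + 1 / L) ^ k ≤ Real.exp ((√L + 1) / √L ^ 2) := by
      rw [hs2]
      have hL0 : 0 < L := by linarith
      calc (1 + 1 / L) ^ k ≤ Real.exp (1 / L) ^ k := by
            gcongr; rw [add_comm]; exact Real.add_one_le_exp _
        _ = Real.exp (k * (1 / L)) := by rw [← Real.exp_nat_mul]
        _ ≤ _ := by
            apply Real.exp_le_exp.2
            rw [mul_one_div]; gcongr
    have t3 : R * (4 / 9 : ℝ) ^ k ≤ (2 * √L ^ 2 + 1) * Real.exp (-(√L / 2)) := by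
      rw [hs2]; gcongr
    linarith
  exact tendsto_of_tendsto_of_tendsto_of_le_of_le' hlow tendsto_const_nhds
    (hall.mono fun n h => h.2) (hall.mono fun n h => h.1)
end

section
/- If (T_n) is a sequence of trees where T_n has n vertices and maximum degree at most Δ = Δ(n), then a.a.s. G(n,p) contains a copy of T_n whenever p ≥ Δ·(log n)^5/n. -/
open MeasureTheory Filter Topology

set_option linter.unusedSectionVars false

section Abstract
open Finset
variable {X : Type*} [Fintype X] [DecidableEq X]

/-- Weight of the set `W` under the `p`-random subset measure. -/
noncomputable def wt (p : ℝ) (W : Finset X) : ℝ := ∏ x, if x ∈ W then p else 1 - p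

lemma wt_nonneg {p : ℝ} (h0 : 0 ≤ p) (h1 : p ≤ 1) (W : Finset X) : 0 ≤ wt p W := by
  unfold wt
  apply Finset.prod_nonneg
  intro x _
  split_ifs <;> linarith

lemma wt_sum (p : ℝ) : ∑ W : Finset X, wt p W = 1 := by
  have h := Finset.prod_add (fun _ : X => p) (fun _ => 1 - p) univ
  simp only [add_sub_cancel, Finset.prod_const_one, Finset.powerset_univ] at h
  rw [h]
  refine Finset.sum_congr rfl fun W _ => ?_
  unfold wt
  rw [Finset.prod_ite]
  congr 1
  · congr 1; ext; simp
  · congr 1; ext; simp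

lemma wt_sdiff {p : ℝ} (h0 : 0 < p) (h1 : p ≤ 1) (Z S : Finset X) :
    wt p (Z \ S) ≤ wt p Z * (1 / p) ^ S.card := by
  have e : p ^ S.card = ∏ x : X, if x ∈ S then p else 1 := by
    simp
  have key : wt p (Z \ S) * p ^ S.card ≤ wt p Z := by
    rw [e]
    unfold wt
    rw [← Finset.prod_mul_distrib]
    apply Finset.prod_le_prod
    · intro x _
      apply mul_nonneg <;> split_ifs <;> linarith
    · intro x _
      by_cases hS : x ∈ S <;> by_cases hZ : x ∈ Z <;> simp [hS, hZ] <;> nlinarith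
  rw [one_div, inv_pow, ← div_eq_mul_inv, le_div_iff₀ (by positivity)]
  exact key

/-- The finset determined by a Boolean function. -/
def toF (ω : X → Bool) : Finset X := univ.filter fun x => ω x = true

lemma toF_bij : Function.Bijective (toF : (X → Bool) → Finset X) := by
  constructor
  · intro a b h
    funext x
    have : x ∈ toF a ↔ x ∈ toF b := by rw [h]
    simp only [toF, mem_filter, mem_univ, true_and] at this
    exact Bool.eq_iff_iff.2 this
  · intro W
    exact ⟨fun x => decide (x ∈ W), by ext; simp [toF]⟩

lemma wt_toF (p : ℝ) (ω : X → Bool) :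
    wt p (toF ω) = ∏ x, (if ω x = true then p else 1 - p) := by
  simp [wt, toF]

lemma wt_union (a b : ℝ) (g : Finset X → ℝ) :
    ∑ W₁ : Finset X, ∑ W₂ : Finset X, wt a W₁ * wt b W₂ * g (W₁ ∪ W₂)
      = ∑ W : Finset X, wt (1 - (1 - a) * (1 - b)) W * g W := by
  set c := 1 - (1 - a) * (1 - b) with hc
  let w : ℝ → Bool → ℝ := fun p b => if b = true then p else 1 - p
  have hU : ∀ ω₁ ω₂ : X → Bool, toF ω₁ ∪ toF ω₂ = toF (fun x => ω₁ x || ω₂ x) := by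
    intro ω₁ ω₂; ext x; simp [toF]
  have h1 : ∑ W₁ : Finset X, ∑ W₂ : Finset X, wt a W₁ * wt b W₂ * g (W₁ ∪ W₂)
      = ∑ ω : (X → Bool) × (X → Bool), (∏ x, w a (ω.1 x) * w b (ω.2 x)) *
          g (toF (fun x => ω.1 x || ω.2 x)) := by
    rw [Fintype.sum_prod_type, ← toF_bij.sum_comp]
    refine Finset.sum_congr rfl fun ω₁ _ => ?_
    rw [← toF_bij.sum_comp]
    refine Finset.sum_congr rfl fun ω₂ _ => ?_
    rw [hU, wt_toF, wt_toF, Finset.prod_mul_distrib]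
  rw [h1, ← toF_bij.sum_comp,
    ← (Equiv.arrowProdEquivProdArrow X (fun _ => Bool) (fun _ => Bool)).sum_comp]
  rw [← Finset.sum_fiberwise_of_maps_to (s := univ) (t := (univ : Finset (X → Bool)))
    (g := fun (ω : X → Bool × Bool) => fun x => (ω x).1 || (ω x).2) (fun _ _ => mem_univ _)]
  refine Finset.sum_congr rfl fun ω _ => ?_
  rw [wt_toF]
  have h2 : (∏ x, (if ω x = true then c else 1 - c)) =
      ∏ x, ∑ y ∈ (univ.filter fun y : Bool × Bool => (y.1 || y.2) = ω x), w a y.1 * w b y.2 := by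
    refine Finset.prod_congr rfl fun x _ => ?_
    cases ω x
    · rw [show (univ.filter fun y : Bool × Bool => (y.1 || y.2) = false) = {(false, false)} by
        decide]
      simp [w, hc]
    · rw [show (univ.filter fun y : Bool × Bool => (y.1 || y.2) = true)
        = {(true, false), (false, true), (true, true)} by decide]
      simp [w, hc]
      ring
  rw [h2, Finset.prod_univ_sum, Finset.sum_mul]
  refine Finset.sum_congr ?_ fun v hv => ?_
  · ext v
    simp [Fintype.mem_piFinset, funext_iff]
  · rw [Fintype.mem_piFinset] at hv
    have : (fun x => (v x).1 || (v x).2) = ω := by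
      funext x; have := hv x; simpa using this
    simp only [Equiv.arrowProdEquivProdArrow, Equiv.coe_fn_mk, this]

variable {I : Type*} [DecidableEq I]

lemma exists_frag_s10 (J : Finset I) (A : I → Finset X) :
    ∃ T : Finset X → I → Finset X, ∀ W, ∀ i ∈ J, T W i ⊆ A i ∧ Disjoint (T W i) W ∧
      (∃ j ∈ J, A j ⊆ W ∪ T W i) ∧ ∀ j ∈ J, A j ⊆ W ∪ T W i → T W i ⊆ A j := by
  have : ∀ W i, ∃ S : Finset X, i ∈ J → (S ⊆ A i ∧ Disjoint S W ∧
      (∃ j ∈ J, A j ⊆ W ∪ S) ∧ ∀ j ∈ J, A j ⊆ W ∪ S → S ⊆ A j) := by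
    intro W i
    by_cases hi : i ∈ J
    swap
    · exact ⟨∅, fun h => absurd h hi⟩
    obtain ⟨m, hm, hmin⟩ := Finset.exists_min_image (J.filter fun j => A j ⊆ W ∪ A i)
      (fun j => (A j \ W).card) ⟨i, by simp [hi]⟩
    rw [mem_filter] at hm
    refine ⟨A m \ W, fun _ => ⟨?_, sdiff_disjoint, ⟨m, hm.1, ?_⟩, ?_⟩⟩
    · intro x hx
      rw [Finset.mem_sdiff] at hx
      have := hm.2 hx.1
      rw [mem_union] at this
      tauto
    · intro x hx
      simp only [mem_union, Finset.mem_sdiff]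
      tauto
    · intro j hj hsub
      have h1 : A j ⊆ W ∪ A i := by
        intro x hx
        have h2 := hsub hx
        simp only [mem_union, Finset.mem_sdiff] at h2 ⊢
        rcases h2 with h2 | h2
        · exact Or.inl h2
        · have := hm.2 h2.1
          rw [mem_union] at this
          exact this
      have h3 := hmin j (by rw [mem_filter]; exact ⟨hj, h1⟩)
      have h4 : A j \ W ⊆ A m \ W := by
        intro x hx
        rw [Finset.mem_sdiff] at hx
        have h2 := hsub hx.1
        rw [mem_union] at h2
        tauto
      have h5 := Finset.eq_of_subset_of_card_le h4 h3
      rw [← h5]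
      exact sdiff_subset
  choose T hT using this
  exact ⟨T, fun W i hi => hT W i hi⟩

lemma bad_bound {p q N : ℝ} (hp0 : 0 < p) (hp1 : p ≤ 1) (hq : 0 ≤ q) (hqp : 4 * q ≤ p)
    (hN : 0 ≤ N) (k : ℕ) (J : Finset I) (A : I → Finset X)
    (hA : ∀ i ∈ J, (A i).card < 2 ^ (k + 1))
    (hs : ∀ U : Finset X, ((J.filter fun i => U ⊆ A i).card : ℝ) ≤ q ^ U.card * N)
    (T : Finset X → I → Finset X)
    (hT : ∀ W, ∀ i ∈ J, T W i ⊆ A i ∧ Disjoint (T W i) W ∧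
      (∃ j ∈ J, A j ⊆ W ∪ T W i) ∧ ∀ j ∈ J, A j ⊆ W ∪ T W i → T W i ⊆ A j) :
    ∑ W : Finset X, wt p W * ((J.filter fun i => ¬ (T W i).card < 2 ^ k).card : ℝ)
      ≤ 4 * q / p * N := by
  have hS : ∃ S : Finset X → Finset X, ∀ Z, (S Z).card ≤ 2 ^ (k + 1) ∧
      ((∃ j ∈ J, A j ⊆ Z) → ∃ j ∈ J, A j ⊆ Z ∧ S Z = A j) := by
    have : ∀ Z, ∃ S : Finset X, S.card ≤ 2 ^ (k + 1) ∧
      ((∃ j ∈ J, A j ⊆ Z) → ∃ j ∈ J, A j ⊆ Z ∧ S = A j) := by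
      intro Z
      by_cases h : ∃ j ∈ J, A j ⊆ Z
      · obtain ⟨j, hj, hjZ⟩ := h
        exact ⟨A j, (hA j hj).le, fun _ => ⟨j, hj, hjZ, rfl⟩⟩
      · exact ⟨∅, by simp, fun h' => absurd h' h⟩
    choose S hS using this
    exact ⟨S, hS⟩
  obtain ⟨S, hS⟩ := hS
  have e1 : ∑ W : Finset X, wt p W * ((J.filter fun i => ¬ (T W i).card < 2 ^ k).card : ℝ)
      = ∑ a ∈ (univ ×ˢ J : Finset (Finset X × I)).filter (fun a => ¬ (T a.1 a.2).card < 2 ^ k),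
        wt p a.1 := by
    rw [Finset.sum_filter, Finset.sum_product]
    refine Finset.sum_congr rfl fun W _ => ?_
    rw [← Finset.sum_filter]; simp only [Finset.sum_const, nsmul_eq_mul]; rw [mul_comm]
  let φ : Finset X × I → Finset X × Finset X × I :=
    fun a => (a.1 ∪ T a.1 a.2, T a.1 a.2, a.2)
  let P := (univ ×ˢ J : Finset (Finset X × I)).filter (fun a => ¬ (T a.1 a.2).card < 2 ^ k)
  have hsd : ∀ a ∈ P, (a.1 ∪ T a.1 a.2) \ T a.1 a.2 = a.1 := by
    intro a ha
    have ha' : a.2 ∈ J := by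
      simp only [P, mem_filter, mem_product] at ha; exact ha.1.2
    have := (hT a.1 a.2 ha').2.1
    rw [Finset.union_sdiff_right]
    exact Finset.sdiff_eq_self_of_disjoint this.symm
  have hinj : Set.InjOn φ P := by
    intro a ha b hb hab
    simp only [φ, Prod.mk.injEq] at hab
    have h1 := hsd a ha
    have h2 := hsd b hb
    rw [hab.1, hab.2.1, h2] at h1
    exact Prod.ext h1.symm hab.2.2
  let Q : Finset (Finset X × Finset X × I) :=
    ((univ : Finset (Finset X)) ×ˢ (univ : Finset (Finset X)) ×ˢ J).filter
      (fun b => (b.2.1 ⊆ S b.1 ∧ ¬ b.2.1.card < 2 ^ k) ∧ b.2.1 ⊆ A b.2.2)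
  have hsub : P.image φ ⊆ Q := by
    intro b hb
    rw [mem_image] at hb
    obtain ⟨a, ha, rfl⟩ := hb
    simp only [P, mem_filter, mem_product, mem_univ, true_and] at ha
    obtain ⟨t1, t2, t3, t4⟩ := hT a.1 a.2 ha.1
    obtain ⟨j, hj, hj1, hj2⟩ := (hS (a.1 ∪ T a.1 a.2)).2 t3
    simp only [Q, φ, mem_filter, mem_product, mem_univ, true_and]
    refine ⟨ha.1, ⟨?_, ha.2⟩, t1⟩
    rw [hj2]
    exact t4 j hj hj1
  have e2 : ∑ a ∈ P, wt p a.1 ≤ ∑ b ∈ Q, wt p (b.1 \ b.2.1) := by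
    calc ∑ a ∈ P, wt p a.1 = ∑ b ∈ P.image φ, wt p (b.1 \ b.2.1) := by
          rw [Finset.sum_image hinj]
          refine Finset.sum_congr rfl fun a ha => ?_
          simp only [φ]
          rw [hsd a ha]
      _ ≤ _ := Finset.sum_le_sum_of_subset_of_nonneg hsub
          fun b _ _ => wt_nonneg hp0.le hp1 _
  have e3 : ∑ b ∈ Q, wt p (b.1 \ b.2.1) = ∑ Z : Finset X,
      ∑ U ∈ (S Z).powerset.filter (fun U => ¬ U.card < 2 ^ k),
        ((J.filter fun i => U ⊆ A i).card : ℝ) * wt p (Z \ U) := by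
    simp only [Q]
    rw [Finset.sum_filter, Finset.sum_product]
    refine Finset.sum_congr rfl fun Z _ => ?_
    rw [Finset.sum_product]
    have : (S Z).powerset.filter (fun U => ¬ U.card < 2 ^ k)
        = univ.filter (fun U => U ⊆ S Z ∧ ¬ U.card < 2 ^ k) := by
      ext U; simp
    rw [this, Finset.sum_filter]
    refine Finset.sum_congr rfl fun U _ => ?_
    by_cases h : U ⊆ S Z ∧ ¬ U.card < 2 ^ k
    · simp only [h, not_false_eq_true, and_self, true_and, if_true]
      rw [← Finset.sum_filter, Finset.sum_const, nsmul_eq_mul]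
    · simp only [h, false_and, if_false, Finset.sum_const_zero]
  have hqp' : 0 ≤ q / p := div_nonneg hq hp0.le
  have hqp1 : 4 * (q / p) ≤ 1 := by
    rw [← mul_div_assoc, div_le_one hp0]; exact hqp
  have e4 : ∀ Z : Finset X, ∑ U ∈ (S Z).powerset.filter (fun U => ¬ U.card < 2 ^ k),
        ((J.filter fun i => U ⊆ A i).card : ℝ) * wt p (Z \ U) ≤ wt p Z * (4 * q / p * N) := by
    intro Z
    have hw := wt_nonneg hp0.le hp1 Z
    calc _ ≤ ∑ U ∈ (S Z).powerset.filter (fun U => ¬ U.card < 2 ^ k),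
          wt p Z * N * (q / p) ^ (2 ^ k) := by
          refine Finset.sum_le_sum fun U hU => ?_
          have hU' : 2 ^ k ≤ U.card := by
            have := (mem_filter.1 hU).2; omega
          calc ((J.filter fun i => U ⊆ A i).card : ℝ) * wt p (Z \ U)
              ≤ (q ^ U.card * N) * (wt p Z * (1 / p) ^ U.card) :=
                mul_le_mul (hs U) (wt_sdiff hp0 hp1 Z U) (wt_nonneg hp0.le hp1 _) (by positivity)
            _ = wt p Z * N * (q / p) ^ U.card := by
                rw [div_pow, div_pow, one_pow]; field_simp
            _ ≤ _ := by
                apply mul_le_mul_of_nonneg_left _ (by positivity)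
                exact pow_le_pow_of_le_one hqp' (by linarith) hU'
      _ = (((S Z).powerset.filter (fun U => ¬ U.card < 2 ^ k)).card : ℝ) *
          (wt p Z * N * (q / p) ^ (2 ^ k)) := by
          rw [Finset.sum_const, nsmul_eq_mul]
      _ ≤ (2 : ℝ) ^ (2 ^ (k + 1)) * (wt p Z * N * (q / p) ^ (2 ^ k)) := by
          apply mul_le_mul_of_nonneg_right _ (by positivity)
          have h1 : ((S Z).powerset.filter (fun U => ¬ U.card < 2 ^ k)).card
              ≤ 2 ^ (2 ^ (k + 1)) := by
            refine (Finset.card_filter_le _ _).trans ?_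
            rw [Finset.card_powerset]
            exact Nat.pow_le_pow_right (by norm_num) (hS Z).1
          exact_mod_cast h1
      _ = wt p Z * ((4 * (q / p)) ^ (2 ^ k) * N) := by
          rw [pow_succ 2 k, mul_comm (2 ^ k) 2, pow_mul, mul_pow]
          norm_num
          ring
      _ ≤ wt p Z * (4 * q / p * N) := by
          apply mul_le_mul_of_nonneg_left _ hw
          apply mul_le_mul_of_nonneg_right _ hN
          rw [mul_div_assoc]
          exact pow_le_of_le_one (by positivity) hqp1 (by positivity)
  calc _ = ∑ a ∈ P, wt p a.1 := e1
    _ ≤ _ := e2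
    _ = _ := e3
    _ ≤ ∑ Z : Finset X, wt p Z * (4 * q / p * N) := Finset.sum_le_sum fun Z _ => e4 Z
    _ = 4 * q / p * N := by rw [← Finset.sum_mul, wt_sum, one_mul]

open Classical in
theorem spread_iter {p q N : ℝ} (hp0 : 0 < p) (hp1 : p ≤ 1) (hq : 0 ≤ q) (hqp : 4 * q ≤ p)
    (hN : 0 ≤ N) : ∀ (k : ℕ) (J : Finset I) (A : I → Finset X),
    (∀ i ∈ J, (A i).card < 2 ^ k) →
    (∀ U : Finset X, ((J.filter fun i => U ⊆ A i).card : ℝ) ≤ q ^ U.card * N) →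
    (J.card : ℝ) * ∑ W : Finset X, wt (1 - (1 - p) ^ k) W *
      (if ∀ i ∈ J, ¬ A i ⊆ W then 1 else 0) ≤ k * (4 * q / p) * N := by
  intro k
  induction k with
  | zero =>
    intro J A hA _
    rcases J.eq_empty_or_nonempty with rfl | ⟨i, hi⟩
    · simp
    · have h0 : A i = ∅ := by
        have := hA i hi; simpa using this
      have : ∀ W : Finset X, ¬ ∀ i ∈ J, ¬ A i ⊆ W := by
        intro W h
        exact h i hi (by simp [h0])
      simp [this]
  | succ k ih =>
    intro J A hA hs
    obtain ⟨T, hT⟩ := exists_frag_s10 J A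
    have hbad := bad_bound hp0 hp1 hq hqp hN k J A hA hs T hT
    set c := 1 - (1 - p) ^ k with hc
    have hc0 : 0 ≤ c := by
      have : (1 - p) ^ k ≤ 1 := pow_le_one₀ (by linarith) (by linarith)
      linarith
    have hc1 : c ≤ 1 := by
      have : 0 ≤ (1 - p) ^ k := pow_nonneg (by linarith) _
      linarith
    have hcc : 1 - (1 - p) ^ (k + 1) = 1 - (1 - p) * (1 - c) := by
      rw [hc]; ring
    rw [hcc, ← wt_union, Finset.mul_sum]
    have key : ∀ W₁ : Finset X, (J.card : ℝ) * ∑ W₂ : Finset X, wt p W₁ * wt c W₂ *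
        (if ∀ i ∈ J, ¬ A i ⊆ W₁ ∪ W₂ then 1 else 0) ≤
        wt p W₁ * (k * (4 * q / p) * N) +
        wt p W₁ * ((J.filter fun i => ¬ (T W₁ i).card < 2 ^ k).card : ℝ) := by
      intro W₁
      have hw := wt_nonneg hp0.le hp1 W₁
      set J' := J.filter fun i => (T W₁ i).card < 2 ^ k with hJ'
      have hih := ih J' (T W₁) (fun i hi => (mem_filter.1 hi).2) (by
        intro U
        refine le_trans ?_ (hs U)
        have : J'.filter (fun i => U ⊆ T W₁ i) ⊆ J.filter fun i => U ⊆ A i := by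
          intro i hi
          rw [mem_filter, hJ', mem_filter] at hi
          rw [mem_filter]
          exact ⟨hi.1.1, hi.2.trans (hT W₁ i hi.1.1).1⟩
        exact_mod_cast Finset.card_le_card this)
      have hle : ∀ W₂ : Finset X, (if ∀ i ∈ J, ¬ A i ⊆ W₁ ∪ W₂ then (1 : ℝ) else 0) ≤
          (if ∀ i ∈ J', ¬ T W₁ i ⊆ W₂ then 1 else 0) := by
        intro W₂
        by_cases h : ∀ i ∈ J, ¬ A i ⊆ W₁ ∪ W₂
        · have h' : ∀ i ∈ J', ¬ T W₁ i ⊆ W₂ := by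
            intro i hi hsub
            obtain ⟨j, hj, hjs⟩ := (hT W₁ i (mem_filter.1 hi).1).2.2.1
            exact h j hj (hjs.trans (Finset.union_subset_union_right hsub))
          rw [if_pos h, if_pos h']
        · rw [if_neg h]; split_ifs <;> norm_num
      set F := ∑ W₂ : Finset X, wt c W₂ * (if ∀ i ∈ J', ¬ T W₁ i ⊆ W₂ then (1 : ℝ) else 0) with hF
      have hF1 : F ≤ 1 := by
        rw [← wt_sum (X := X) c]
        refine Finset.sum_le_sum fun W _ => ?_
        have := wt_nonneg hc0 hc1 W
        split_ifs <;> linarith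
      have hcard : (J.card : ℝ) = J'.card +
          ((J.filter fun i => ¬ (T W₁ i).card < 2 ^ k).card : ℝ) := by
        rw [hJ']
        exact_mod_cast (Finset.card_filter_add_card_filter_not (s := J) _).symm
      calc (J.card : ℝ) * ∑ W₂ : Finset X, wt p W₁ * wt c W₂ *
            (if ∀ i ∈ J, ¬ A i ⊆ W₁ ∪ W₂ then 1 else 0)
          ≤ (J.card : ℝ) * (wt p W₁ * F) := by
            apply mul_le_mul_of_nonneg_left _ (by positivity)
            rw [hF, Finset.mul_sum]
            refine Finset.sum_le_sum fun W₂ _ => ?_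
            rw [mul_assoc]
            apply mul_le_mul_of_nonneg_left _ hw
            exact mul_le_mul_of_nonneg_left (hle W₂) (wt_nonneg hc0 hc1 _)
        _ = wt p W₁ * (J'.card * F) +
            wt p W₁ * (((J.filter fun i => ¬ (T W₁ i).card < 2 ^ k).card : ℝ) * F) := by
            rw [hcard]; ring
        _ ≤ _ := by
            apply add_le_add
            · exact mul_le_mul_of_nonneg_left hih hw
            · apply mul_le_mul_of_nonneg_left _ hw
              exact mul_le_of_le_one_right (by positivity) hF1
    calc _ ≤ ∑ W₁ : Finset X, (wt p W₁ * (k * (4 * q / p) * N) +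
        wt p W₁ * ((J.filter fun i => ¬ (T W₁ i).card < 2 ^ k).card : ℝ)) :=
          Finset.sum_le_sum fun W₁ _ => key W₁
      _ ≤ k * (4 * q / p) * N + 4 * q / p * N := by
          rw [Finset.sum_add_distrib, ← Finset.sum_mul, wt_sum, one_mul]
          linarith
      _ = _ := by push_cast; ring

open Classical in
/-- Probability that the `p`-random set satisfies `C`. -/
noncomputable def rprob (p : ℝ) (C : Finset X → Prop) : ℝ :=
  ∑ W : Finset X, wt p W * (if C W then 1 else 0)

theorem spread_cor {p q N : ℝ} (hp0 : 0 < p) (hp1 : p ≤ 1) (hq : 0 ≤ q) (hqp : 4 * q ≤ p)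
    (hN : 0 ≤ N) (k : ℕ) (J : Finset I) (A : I → Finset X)
    (hA : ∀ i ∈ J, (A i).card < 2 ^ k)
    (hs : ∀ U : Finset X, ((J.filter fun i => U ⊆ A i).card : ℝ) ≤ q ^ U.card * N) :
    (J.card : ℝ) * rprob (1 - (1 - p) ^ k) (fun W => ∀ i ∈ J, ¬ A i ⊆ W)
      ≤ k * (4 * q / p) * N := by
  have := spread_iter hp0 hp1 hq hqp hN k J A hA hs
  unfold rprob
  convert this

end Abstract
section Trees
open Finset
variable {V : Type*} [Fintype V] [DecidableEq V]

lemma tree_parent_unique {G : SimpleGraph V} (hG : G.IsTree) (r x y z : V) (hx : G.Adj x y)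
    (hz : G.Adj z y) (hdx : G.dist r x < G.dist r y) (hdz : G.dist r z < G.dist r y) : x = z := by
  obtain ⟨p, hp⟩ := hG.1.exists_walk_length_eq_dist r x
  obtain ⟨q, hq⟩ := hG.1.exists_walk_length_eq_dist r z
  have h1 : (p.concat hx).length = G.dist r y := by
    have := SimpleGraph.dist_le (p.concat hx)
    rw [SimpleGraph.Walk.length_concat] at this ⊢
    omega
  have h2 : (q.concat hz).length = G.dist r y := by
    have := SimpleGraph.dist_le (q.concat hz)
    rw [SimpleGraph.Walk.length_concat] at this ⊢
    omega
  have h3 := (hG.existsUnique_path r y).unique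
    (SimpleGraph.Walk.isPath_of_length_eq_dist _ h1)
    (SimpleGraph.Walk.isPath_of_length_eq_dist _ h2)
  have h4 := congrArg SimpleGraph.Walk.penultimate h3
  simpa using h4

lemma exists_leaf {G : SimpleGraph V} (hG : G.IsTree) (U : Finset (Sym2 V))
    (hU : ∀ e ∈ U, e ∈ G.edgeSet) (hne : U.Nonempty) :
    ∃ x y, s(x, y) ∈ U ∧ x ≠ y ∧ ∀ e ∈ U, y ∈ e → e = s(x, y) := by
  obtain ⟨e, he⟩ := hne
  obtain ⟨r⟩ := hG.1.nonempty
  have hne : ((univ : Finset (V × V)).filter fun a => s(a.1, a.2) ∈ U).Nonempty := by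
    induction e using Sym2.ind with
    | _ a b => exact ⟨(a, b), by simpa using he⟩
  obtain ⟨⟨x, y⟩, hxy, hmax⟩ := Finset.exists_max_image _ (fun a : V × V => G.dist r a.2) hne
  simp only [mem_filter, mem_univ, true_and, Prod.forall] at hxy hmax
  have key : ∀ z, s(z, y) ∈ U → G.Adj z y ∧ G.dist r z < G.dist r y := by
    intro z hz
    have hadj : G.Adj z y := hU _ hz
    refine ⟨hadj, lt_of_le_of_ne (hmax y z (by rwa [Sym2.eq_swap])) (hG.dist_ne_of_adj r hadj)⟩
  refine ⟨x, y, hxy, (key x hxy).1.ne, ?_⟩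
  intro e he hy
  obtain ⟨z, rfl⟩ := Sym2.mem_iff_exists.1 hy
  rw [Sym2.eq_swap] at he
  rw [tree_parent_unique hG r x y z (key x hxy).1 (key z he).1 (key x hxy).2 (key z he).2,
    Sym2.eq_swap]

open Classical in
lemma hom_count {G H : SimpleGraph V} (hG : G.IsTree) (D : ℕ)
    (hD : ∀ v, (univ.filter fun w => H.Adj v w).card ≤ D) :
    ∀ (m : ℕ) (U : Finset (Sym2 V)), U.card = m → (∀ e ∈ U, e ∈ G.edgeSet) →
    (univ.filter fun f : V → V => ∀ e ∈ U, Sym2.map f e ∈ H.edgeSet).card * Fintype.card V ^ m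
      ≤ Fintype.card V ^ Fintype.card V * D ^ m := by
  intro m
  induction m with
  | zero =>
    intro U hc hU
    rw [Finset.card_eq_zero] at hc
    subst hc
    simp
  | succ m ih =>
    intro U hc hU
    obtain ⟨x, y, hxy, hne, hleaf⟩ := exists_leaf hG U hU (by
      rw [← Finset.card_pos]; omega)
    set U' := U.erase s(x, y) with hU'
    have hih := ih U' (by rw [hU', Finset.card_erase_of_mem hxy]; omega)
      (fun e he => hU e (Finset.mem_of_mem_erase he))
    have hmap : ∀ e ∈ U', ∀ (f : V → V) (z : V),
        Sym2.map (Function.update f y z) e = Sym2.map f e := by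
      intro e he f z
      apply Sym2.map_congr
      intro a ha
      rw [Function.update_of_ne]
      rintro rfl
      rw [hU', Finset.mem_erase] at he
      exact he.1 (hleaf e he.2 ha)
    have step : (univ.filter fun f : V → V => ∀ e ∈ U, Sym2.map f e ∈ H.edgeSet).card
        * Fintype.card V ≤ D *
        (univ.filter fun f : V → V => ∀ e ∈ U', Sym2.map f e ∈ H.edgeSet).card := by
      rw [← Finset.card_univ, ← Finset.card_product]
      apply Finset.card_le_mul_card_image_of_maps_to
        (f := fun a : (V → V) × V => Function.update a.1 y a.2)
      · rintro ⟨f, z⟩ h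
        simp only [mem_product, mem_filter, mem_univ, true_and, and_true] at h
        simp only [mem_filter, mem_univ, true_and]
        intro e he
        rw [hmap e he]
        exact h e (Finset.mem_of_mem_erase he)
      · intro g _
        refine le_trans ?_ (hD (g x))
        apply Finset.card_le_card_of_injOn (fun a : (V → V) × V => a.1 y)
        · rintro ⟨f, z⟩ h
          simp only [coe_filter, mem_product, mem_filter, mem_univ, true_and, and_true,
            Set.mem_ofPred_eq] at h ⊢
          have h1 := h.1 _ hxy
          rw [Sym2.map_mk, SimpleGraph.mem_edgeSet] at h1
          rw [← h.2, Function.update_of_ne hne]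
          exact h1
        · rintro ⟨f, z⟩ h ⟨f', z'⟩ h' heq
          simp only [coe_filter, mem_product, mem_filter, mem_univ, true_and, and_true,
            Set.mem_ofPred_eq] at h h' heq
          have e1 := h.2
          have e2 := h'.2
          rw [← e2] at e1
          refine Prod.ext ?_ ?_
          · funext a
            by_cases ha : a = y
            · subst ha; exact heq
            · have := congrFun e1 a
              rwa [Function.update_of_ne ha, Function.update_of_ne ha] at this
          · have := congrFun e1 y
            rwa [Function.update_self, Function.update_self] at this
    calc _ = ((univ.filter fun f : V → V => ∀ e ∈ U, Sym2.map f e ∈ H.edgeSet).card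
        * Fintype.card V) * Fintype.card V ^ m := by rw [pow_succ]; ring
      _ ≤ (D * (univ.filter fun f : V → V => ∀ e ∈ U', Sym2.map f e ∈ H.edgeSet).card) *
          Fintype.card V ^ m := Nat.mul_le_mul_right _ step
      _ = D * ((univ.filter fun f : V → V => ∀ e ∈ U', Sym2.map f e ∈ H.edgeSet).card *
          Fintype.card V ^ m) := by ring
      _ ≤ D * (Fintype.card V ^ Fintype.card V * D ^ m) := Nat.mul_le_mul_left _ hih
      _ = _ := by rw [pow_succ]; ring

lemma card_perm_agree (B : Finset V) (g : V → V) :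
    (univ.filter fun τ : Equiv.Perm V => ∀ a ∈ B, τ a = g a).card
      ≤ (Fintype.card V - B.card).factorial := by
  by_cases h : ∃ τ₀ : Equiv.Perm V, ∀ a ∈ B, τ₀ a = g a
  swap
  · have : (univ.filter fun τ : Equiv.Perm V => ∀ a ∈ B, τ a = g a) = ∅ := by
      rw [Finset.filter_eq_empty_iff]
      intro τ _ hτ
      exact h ⟨τ, hτ⟩
    rw [this]; simp
  obtain ⟨τ₀, h0⟩ := h
  have h1 : Fintype.card (Equiv.Perm {a // a ∉ B}) = (Fintype.card V - B.card).factorial := by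
    rw [Fintype.card_perm, Fintype.card_subtype_compl, Fintype.card_coe]
  rw [← h1, Fintype.card_congr (Equiv.Perm.subtypeEquivSubtypePerm (fun a => a ∉ B)),
    Fintype.card_subtype]
  apply Finset.card_le_card_of_injOn (fun τ => τ₀⁻¹ * τ)
  · intro τ hτ
    simp only [coe_filter, mem_univ, true_and, Set.mem_ofPred_eq, not_not] at hτ ⊢
    intro a ha
    rw [Equiv.Perm.mul_apply, hτ a ha, ← h0 a ha]
    simp
  · intro τ _ τ' _ h
    exact mul_left_cancel h

lemma pow_factorial_bound : ∀ (n v : ℕ), v ≤ n →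
    (n : ℝ) ^ v * ((n - v).factorial : ℝ) ≤ n.factorial * Real.exp v := by
  intro n
  induction n with
  | zero => intro v hv; obtain rfl : v = 0 := by omega
            simp
  | succ n ih =>
    intro v hv
    cases v with
    | zero => simp
    | succ v =>
      have hv' : v ≤ n := by omega
      have h := ih v hv'
      rw [Nat.add_sub_add_right, Nat.factorial_succ]
      rcases Nat.eq_zero_or_pos n with rfl | hn
      · obtain rfl : v = 0 := by omega
        simp
      have hn' : (0 : ℝ) < n := by exact_mod_cast hn
      have h2 : ((n : ℝ) + 1) ^ v ≤ n ^ v * Real.exp 1 := by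
        have h3 : (n : ℝ) + 1 ≤ n * Real.exp (1 / n) := by
          have := Real.add_one_le_exp (1 / (n : ℝ))
          calc (n : ℝ) + 1 = n * (1 / n + 1) := by field_simp; ring
            _ ≤ _ := by gcongr
        calc ((n : ℝ) + 1) ^ v ≤ (n * Real.exp (1 / n)) ^ v := by gcongr
          _ = n ^ v * Real.exp (v * (1 / n)) := by rw [mul_pow, ← Real.exp_nat_mul]
          _ ≤ n ^ v * Real.exp 1 := by
            gcongr
            rw [mul_one_div, div_le_one hn']
            exact_mod_cast hv'
      push_cast
      calc ((n : ℝ) + 1) ^ (v + 1) * ((n - v).factorial : ℝ)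
          = ((n : ℝ) + 1) * (((n : ℝ) + 1) ^ v * ((n - v).factorial : ℝ)) := by ring
        _ ≤ ((n : ℝ) + 1) * ((n ^ v * Real.exp 1) * ((n - v).factorial : ℝ)) := by gcongr
        _ = ((n : ℝ) + 1) * ((n ^ v * ((n - v).factorial : ℝ)) * Real.exp 1) := by ring
        _ ≤ ((n : ℝ) + 1) * ((n.factorial * Real.exp v) * Real.exp 1) := by gcongr
        _ = _ := by rw [Real.exp_add]; ring

open Classical in
lemma perm_count {G H : SimpleGraph V} (hG : G.IsTree) (D : ℕ)
    (hD : ∀ v, (univ.filter fun w => H.Adj v w).card ≤ D) (U : Finset (Sym2 V))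
    (hU : ∀ e ∈ U, e ∈ G.edgeSet) :
    ((univ.filter fun τ : Equiv.Perm V => ∀ e ∈ U, Sym2.map τ e ∈ H.edgeSet).card : ℝ)
      ≤ (Real.exp 2 * D / Fintype.card V) ^ U.card * (Fintype.card V).factorial := by
  set n := Fintype.card V with hn
  have hn0 : 0 < n := by
    have := hG.1.nonempty
    exact Fintype.card_pos
  set B : Finset V := U.biUnion fun e => univ.filter fun a => a ∈ e with hB
  have hBc : B.card ≤ U.card * 2 := by
    apply Finset.card_biUnion_le_card_mul
    intro e _
    induction e using Sym2.ind with
    | _ a b =>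
      refine (Finset.card_le_card (t := {a, b}) ?_).trans Finset.card_le_two
      intro c; simp
  have hBn : B.card ≤ n := Finset.card_le_univ B
  have hmem : ∀ e ∈ U, ∀ a ∈ e, a ∈ B := by
    intro e he a ha
    rw [hB, mem_biUnion]
    exact ⟨e, he, by simpa using ha⟩
  set P := univ.filter fun τ : Equiv.Perm V => ∀ e ∈ U, Sym2.map τ e ∈ H.edgeSet with hP
  have hhom := hom_count hG D hD U.card U rfl hU
  set Q := univ.filter fun f : V → V => ∀ e ∈ U, Sym2.map f e ∈ H.edgeSet with hQ
  have hc : P.card * n ^ (n - B.card) ≤ (n - B.card).factorial * Q.card := by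
    have h1 : Fintype.card ({a // a ∉ B} → V) = n ^ (n - B.card) := by
      rw [Fintype.card_fun, Fintype.card_subtype_compl, Fintype.card_coe]
    rw [← h1, ← Finset.card_univ, ← Finset.card_product]
    apply Finset.card_le_mul_card_image_of_maps_to
      (f := fun a : Equiv.Perm V × ({a // a ∉ B} → V) =>
        fun v => if h : v ∈ B then a.1 v else a.2 ⟨v, h⟩)
    · rintro ⟨τ, g⟩ h
      simp only [hP, mem_product, mem_filter, mem_univ,
        true_and, and_true] at h
      simp only [hQ, mem_filter, mem_univ, true_and]
      intro e he
      have := h e he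
      convert this using 1
      apply Sym2.map_congr
      intro a ha
      simp [hmem e he a ha]
    · intro f _
      refine le_trans ?_ (card_perm_agree B f)
      apply Finset.card_le_card_of_injOn (fun a => a.1)
      · rintro ⟨τ, g⟩ h
        simp only [mem_coe, mem_filter, mem_univ, true_and] at h ⊢
        intro a ha
        rw [← h.2]
        simp [ha]
      · rintro ⟨τ, g⟩ h ⟨τ', g'⟩ h' heq
        simp only [mem_coe, mem_filter] at h h' heq
        refine Prod.ext heq ?_
        funext ⟨a, ha⟩
        have := congrFun (h.2.trans h'.2.symm) a
        simpa [ha] using this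
  have hn0' : (0 : ℝ) < n := by exact_mod_cast hn0
  have hc' : (P.card : ℝ) * (n : ℝ) ^ (n - B.card) ≤ ((n - B.card).factorial : ℝ) * Q.card := by
    exact_mod_cast hc
  have hhom' : (Q.card : ℝ) * (n : ℝ) ^ U.card ≤ (n : ℝ) ^ n * (D : ℝ) ^ U.card := by
    exact_mod_cast hhom
  have hpf := pow_factorial_bound n B.card hBn
  have hexp : Real.exp B.card ≤ Real.exp 2 ^ U.card := by
    rw [← Real.exp_nat_mul]
    apply Real.exp_le_exp.2
    exact_mod_cast hBc
  have hsplit : (n : ℝ) ^ n = (n : ℝ) ^ (n - B.card) * (n : ℝ) ^ B.card := by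
    rw [← pow_add]; congr 1; omega
  have hpos : (0 : ℝ) < (n : ℝ) ^ (n - B.card) := by positivity
  rw [div_pow, mul_pow, div_mul_eq_mul_div, le_div_iff₀ (by positivity)]
  refine le_of_mul_le_mul_left ?_ hpos
  calc (n : ℝ) ^ (n - B.card) * ((P.card : ℝ) * (n : ℝ) ^ U.card)
      = ((P.card : ℝ) * (n : ℝ) ^ (n - B.card)) * (n : ℝ) ^ U.card := by ring
    _ ≤ (((n - B.card).factorial : ℝ) * Q.card) * (n : ℝ) ^ U.card := by gcongr
    _ = ((n - B.card).factorial : ℝ) * (Q.card * (n : ℝ) ^ U.card) := by ring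
    _ ≤ ((n - B.card).factorial : ℝ) * ((n : ℝ) ^ n * (D : ℝ) ^ U.card) := by gcongr
    _ = (n : ℝ) ^ (n - B.card) * ((D : ℝ) ^ U.card *
          ((n : ℝ) ^ B.card * ((n - B.card).factorial : ℝ))) := by rw [hsplit]; ring
    _ ≤ (n : ℝ) ^ (n - B.card) * ((D : ℝ) ^ U.card *
          (n.factorial * Real.exp 2 ^ U.card)) := by
        have := hpf.trans (mul_le_mul_of_nonneg_left hexp (by positivity))
        gcongr
    _ = _ := by ring

open Classical in
lemma tree_spread {T : SimpleGraph V} (hT : T.IsTree) (D : ℕ)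
    (hD : ∀ v, (univ.filter fun w => T.Adj v w).card ≤ D) (U : Finset (Sym2 V)) :
    ((univ.filter fun σ : Equiv.Perm V => U ⊆ T.edgeFinset.image (Sym2.map σ)).card : ℝ)
      ≤ (Real.exp 2 * D / Fintype.card V) ^ U.card *
        (Fintype.card V).factorial := by
  have himp : ∀ σ : Equiv.Perm V, U ⊆ T.edgeFinset.image (Sym2.map σ) →
      ∀ e ∈ U, Sym2.map (σ⁻¹ : Equiv.Perm V) e ∈ T.edgeSet := by
    intro σ h e he
    obtain ⟨e', he', rfl⟩ := mem_image.1 (h he)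
    rw [Sym2.map_map]
    have : ((σ⁻¹ : Equiv.Perm V) : V → V) ∘ σ = id := by funext a; simp
    rw [this, Sym2.map_id]
    simpa using he'
  by_cases hex : ∃ σ : Equiv.Perm V, U ⊆ T.edgeFinset.image (Sym2.map σ)
  swap
  · have : (univ.filter fun σ : Equiv.Perm V => U ⊆ T.edgeFinset.image (Sym2.map σ)) = ∅ := by
      rw [Finset.filter_eq_empty_iff]
      intro σ _ hσ
      exact hex ⟨σ, hσ⟩
    rw [this]
    simp only [card_empty, Nat.cast_zero]
    positivity
  obtain ⟨σ₀, h0⟩ := hex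
  have hG : (T.comap (σ₀⁻¹ : Equiv.Perm V)).IsTree :=
    (SimpleGraph.Iso.comap (σ₀⁻¹ : Equiv.Perm V) T).isTree_iff.2 hT
  have hU : ∀ e ∈ U, e ∈ (T.comap (σ₀⁻¹ : Equiv.Perm V)).edgeSet := by
    intro e he
    have := himp σ₀ h0 e he
    induction e using Sym2.ind with
    | _ a b => simpa using this
  refine le_trans ?_ (perm_count hG D hD U hU)
  norm_cast
  apply Finset.card_le_card_of_injOn (fun σ => σ⁻¹)
  · intro σ hσ
    simp only [mem_coe, mem_filter, mem_univ, true_and] at hσ ⊢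
    exact himp σ hσ
  · intro σ _ σ' _ h
    exact inv_injective h

end Trees

section Final
open Finset

lemma bernoulli_true {p : ℝ} (h1 : p ≤ 1) :
    bernoulliMeasure p {true} = ENNReal.ofReal p := by
  have : min (ENNReal.ofReal p) 1 = ENNReal.ofReal p := by
    rw [min_eq_left]; rw [ENNReal.ofReal_le_one]; exact h1
  simp [bernoulliMeasure, this]

lemma bernoulli_false {p : ℝ} (h0 : 0 ≤ p) (h1 : p ≤ 1) :
    bernoulliMeasure p {false} = ENNReal.ofReal (1 - p) := by
  have : min (ENNReal.ofReal p) 1 = ENNReal.ofReal p := by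
    rw [min_eq_left]; rw [ENNReal.ofReal_le_one]; exact h1
  simp [bernoulliMeasure, this, ENNReal.ofReal_sub 1 h0]

instance bernoulli_prob (p : ℝ) : IsProbabilityMeasure (bernoulliMeasure p) := by
  constructor
  simp [bernoulliMeasure]

instance gnp_prob (n : ℕ) (p : ℝ) : IsProbabilityMeasure (gnp n p) := by
  unfold gnp; infer_instance

lemma gnp_singleton {n : ℕ} {p : ℝ} (h0 : 0 ≤ p) (h1 : p ≤ 1) (ω : Sym2 (Fin n) → Bool) :
    gnp n p {ω} = ENNReal.ofReal (wt p (toF ω)) := by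
  rw [gnp, Measure.pi_singleton, wt_toF, ENNReal.ofReal_prod_of_nonneg]
  · refine Finset.prod_congr rfl fun x _ => ?_
    cases ω x
    · simp [bernoulli_false h0 h1]
    · simp [bernoulli_true h1]
  · intro x _
    split_ifs <;> linarith

open Classical in
lemma gnp_set {n : ℕ} {p : ℝ} (h0 : 0 ≤ p) (h1 : p ≤ 1) (C : Finset (Sym2 (Fin n)) → Prop) :
    gnp n p {ω | C (toF ω)} = ENNReal.ofReal (rprob p C) := by
  unfold rprob
  have : {ω : Sym2 (Fin n) → Bool | C (toF ω)} =
      ((univ.filter fun ω : Sym2 (Fin n) → Bool => C (toF ω) : Finset _) : Set _) := by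
    ext; simp
  rw [this, ← sum_measure_singleton, ← toF_bij.sum_comp]
  simp only [mul_ite, mul_one, mul_zero]
  rw [← Finset.sum_filter, ENNReal.ofReal_sum_of_nonneg]
  · exact Finset.sum_congr rfl fun ω _ => gnp_singleton h0 h1 ω
  · intro ω _
    exact wt_nonneg h0 h1 _

lemma maxDeg_bound {n : ℕ} (T : SimpleGraph (Fin n)) [DecidableRel T.Adj] {D : ℕ}
    (h : maxDeg T ≤ D) (v : Fin n) :
    (univ.filter fun w => T.Adj v w).card ≤ D := by
  refine le_trans ?_ h
  have := Finset.le_sup (f := fun v => (T.neighborSet v).ncard) (mem_univ v)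
  refine le_trans (le_of_eq ?_) this
  rw [← Set.ncard_coe_finset]
  congr 1
  ext w; simp

open Classical in
lemma fail_bound {n : ℕ} {T : SimpleGraph (Fin n)} (hT : T.IsTree) {D : ℕ} (hD : maxDeg T ≤ D)
    {p : ℝ} (h0 : 0 < p) (h1 : p ≤ 1) {k : ℕ} (hk : 0 < k) (hnk : n ≤ 2 ^ k)
    (hq : 4 * (Real.exp 2 * D / n) ≤ p / k) :
    gnp n p {ω | ContainsCopy T (graphOf ω)}ᶜ ≤
      ENNReal.ofReal (k * (4 * (Real.exp 2 * D / n) / (p / k))) := by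
  set q := Real.exp 2 * D / n with hqdef
  have hk' : (0 : ℝ) < k := by exact_mod_cast hk
  have hq0 : 0 ≤ q := by positivity
  set p1 := 1 - (1 - p) ^ ((1 : ℝ) / k) with hp1
  have hx0 : 0 ≤ (1 - p) ^ ((1 : ℝ) / k) := Real.rpow_nonneg (by linarith) _
  have hpow : ((1 - p) ^ ((1 : ℝ) / k)) ^ k = 1 - p := by
    rw [one_div]; exact Real.rpow_inv_natCast_pow (by linarith) hk.ne'
  have hp1ge : p / k ≤ p1 := by
    have hb : (1 - p) ≤ (1 - p / k) ^ k := by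
      have hdiv : p / k ≤ 1 := by
        rw [div_le_one hk']
        have : (1 : ℝ) ≤ k := by exact_mod_cast hk
        linarith
      have := one_add_mul_le_pow (a := -(p / k)) (by linarith) k
      have e : 1 + (k : ℝ) * -(p / k) = 1 - p := by field_simp; ring
      rw [e] at this
      simpa [sub_eq_add_neg] using this
    have hdiv : 0 ≤ 1 - p / k := by
      have : p / k ≤ 1 := by
        rw [div_le_one hk']
        have : (1 : ℝ) ≤ k := by exact_mod_cast hk
        linarith
      linarith
    rw [← hpow] at hb
    have := le_of_pow_le_pow_left₀ hk.ne' hdiv hb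
    linarith
  have hpk : 0 < p / k := by positivity
  have hp10 : 0 < p1 := lt_of_lt_of_le hpk hp1ge
  have hp11 : p1 ≤ 1 := by linarith
  have hn1 : T.edgeFinset.card + 1 = n := by
    have := hT.card_edgeFinset; simpa using this
  have main := spread_cor (X := Sym2 (Fin n)) (I := Equiv.Perm (Fin n)) hp10 hp11 hq0
    (hq.trans hp1ge) (N := (n.factorial : ℝ)) (by positivity) k univ
    (fun σ => T.edgeFinset.image (Sym2.map σ))
    (fun σ _ => lt_of_le_of_lt Finset.card_image_le (by omega))
    (fun U => by
      have := tree_spread hT D (fun v => maxDeg_bound T hD v) U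
      rw [Fintype.card_fin] at this
      convert this)
  have e1 : 1 - (1 - p1) ^ k = p := by
    rw [hp1, sub_sub_cancel, hpow, sub_sub_cancel]
  rw [e1, Finset.card_univ, Fintype.card_perm, Fintype.card_fin] at main
  have hf : (0 : ℝ) < n.factorial := by exact_mod_cast n.factorial_pos
  set C : Finset (Sym2 (Fin n)) → Prop :=
    fun W => ∀ σ ∈ (univ : Finset (Equiv.Perm (Fin n))),
        ¬ T.edgeFinset.image (Sym2.map σ) ⊆ W with hC
  generalize hF : rprob p C = F at main
  have main2 : rprob p C ≤ k * (4 * q / (p / k)) := by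
    rw [hF]
    have : F ≤ k * (4 * q / p1) := by
      rw [mul_comm] at main
      exact le_of_mul_le_mul_right main hf
    refine this.trans ?_
    gcongr
  refine le_trans (measure_mono ?_) ((gnp_set h0.le h1 C).le.trans (ENNReal.ofReal_le_ofReal main2))
  intro ω hω
  simp only [Set.mem_compl_iff, Set.mem_ofPred_eq] at hω ⊢
  intro σ _ hsub
  apply hω
  refine ⟨σ, σ.injective, fun u v huv => ?_⟩
  have hmem : s(σ u, σ v) ∈ toF ω := by
    apply hsub
    rw [mem_image]
    exact ⟨s(u, v), by simpa using huv, by simp⟩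
  rw [graphOf, SimpleGraph.fromRel_adj]
  refine ⟨fun h => huv.ne (σ.injective h), Or.inl ?_⟩
  simpa [toF] using hmem

end Final

/-- **Montgomery's theorem.** If `(T_n)` is a sequence of spanning trees with maximum degree
at most `Δ = Δ(n)`, then a.a.s. `G(n,p)` contains a copy of `T_n` whenever
`p ≥ Δ·(log n)⁵/n`. -/
theorem stmt_10 (T : ∀ n : ℕ, SimpleGraph (Fin n)) (Δ : ℕ → ℕ)
    (hT : ∀ᶠ n in atTop, (T n).IsTree) (hΔ : ∀ n, maxDeg (T n) ≤ Δ n)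
    (p : ℕ → ℝ) (hp : ∀ n, 0 ≤ p n ∧ p n ≤ 1)
    (hpge : ∀ᶠ n : ℕ in atTop, (Δ n : ℝ) * Real.log n ^ 5 / n ≤ p n) :
    Tendsto (fun n : ℕ => gnp n (p n) {ω | ContainsCopy (T n) (graphOf ω)}) atTop (𝓝 1) := by
  have hlog : Tendsto (fun n : ℕ => Real.log n) atTop atTop :=
    Real.tendsto_log_atTop.comp tendsto_natCast_atTop_atTop
  have hbound : ∀ᶠ n : ℕ in atTop, gnp n (p n) {ω | ContainsCopy (T n) (graphOf ω)}ᶜ ≤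
      ENNReal.ofReal (36 * Real.exp 2 / Real.log n ^ 3) := by
    filter_upwards [hT, hpge, hlog.eventually_ge_atTop (1 + 12 * Real.exp 2),
      eventually_ge_atTop 2] with n hTn hpn hL hn2
    set L := Real.log n with hLdef
    have hexp : 0 < Real.exp 2 := Real.exp_pos 2
    have hL1 : 1 ≤ L := by linarith
    have hn0 : (0 : ℝ) < n := by
      have : 0 < n := by omega
      exact_mod_cast this
    have hDpos : 1 ≤ Δ n := by
      by_contra hcon
      classical
      have hD0 : Δ n = 0 := by omega
      have hcard : (T n).edgeFinset.card + 1 = n := by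
        have := hTn.card_edgeFinset; simpa using this
      obtain ⟨e, he⟩ : (T n).edgeFinset.Nonempty := by
        rw [← Finset.card_pos]; omega
      induction e using Sym2.ind with
      | _ a b =>
        have h := maxDeg_bound (T n) (hΔ n) a
        rw [hD0, Nat.le_zero, Finset.card_eq_zero, Finset.filter_eq_empty_iff] at h
        exact h (Finset.mem_univ b) (by simpa using he)
    have hD : (1 : ℝ) ≤ (Δ n : ℝ) := by exact_mod_cast hDpos
    have hppos : 0 < p n := lt_of_lt_of_le (by positivity) hpn
    set k := ⌈2 * L⌉₊ with hk
    have hk1 : 2 * L ≤ k := Nat.le_ceil _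
    have hk2 : (k : ℝ) ≤ 3 * L := by
      have := (Nat.ceil_lt_add_one (show 0 ≤ 2 * L by linarith)).le
      linarith
    have hk0 : (0 : ℝ) < k := by linarith
    have hkpos : 0 < k := by exact_mod_cast hk0
    have hnk : n ≤ 2 ^ k := by
      have : (n : ℝ) ≤ 2 ^ k := by
        rw [← Real.log_le_log_iff hn0 (by positivity), Real.log_pow]
        have := Real.log_two_gt_d9
        nlinarith
      exact_mod_cast this
    have hLpos : 0 < L := by linarith
    have hpk : (Δ n : ℝ) * L ^ 4 / (3 * n) ≤ p n / k := by
      calc (Δ n : ℝ) * L ^ 4 / (3 * n) = (Δ n * L ^ 5 / n) / (3 * L) := by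
            field_simp
        _ ≤ p n / k := by gcongr
    have hq : 4 * (Real.exp 2 * Δ n / n) ≤ p n / k := by
      refine le_trans ?_ hpk
      rw [← mul_div_assoc, div_le_div_iff₀ hn0 (by positivity)]
      have h4 : 12 * Real.exp 2 ≤ L ^ 4 := by
        have : L ≤ L ^ 4 := le_self_pow₀ hL1 (by norm_num)
        linarith
      have : 12 * Real.exp 2 * (Δ n * n) ≤ L ^ 4 * (Δ n * n) := by gcongr
      linarith
    refine (fail_bound hTn (hΔ n) hppos (hp n).2 hkpos hnk hq).trans
      (ENNReal.ofReal_le_ofReal ?_)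
    calc (k : ℝ) * (4 * (Real.exp 2 * Δ n / n) / (p n / k))
        ≤ (3 * L) * (4 * (Real.exp 2 * Δ n / n) / ((Δ n : ℝ) * L ^ 4 / (3 * n))) := by
          gcongr
      _ = 36 * Real.exp 2 / L ^ 3 := by
          field_simp; ring
  have hlim : Tendsto (fun n : ℕ => ENNReal.ofReal (36 * Real.exp 2 / Real.log n ^ 3))
      atTop (𝓝 0) := by
    rw [← ENNReal.ofReal_zero]
    apply ENNReal.tendsto_ofReal
    exact Tendsto.div_atTop tendsto_const_nhds
      ((tendsto_pow_atTop (by norm_num : (3 : ℕ) ≠ 0)).comp hlog)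
  have hcompl : Tendsto (fun n : ℕ => gnp n (p n) {ω | ContainsCopy (T n) (graphOf ω)}ᶜ)
      atTop (𝓝 0) :=
    tendsto_of_tendsto_of_tendsto_of_le_of_le' tendsto_const_nhds hlim
      (Eventually.of_forall fun _ => zero_le) hbound
  have hfin : ∀ n, gnp n (p n) {ω | ContainsCopy (T n) (graphOf ω)} =
      1 - gnp n (p n) {ω | ContainsCopy (T n) (graphOf ω)}ᶜ := by
    intro n
    have hm : MeasurableSet {ω : Sym2 (Fin n) → Bool | ContainsCopy (T n) (graphOf ω)}ᶜ :=
      (Set.toFinite _).measurableSet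
    rw [← prob_compl_eq_one_sub hm, compl_compl]
  simp_rw [hfin]
  have := ENNReal.Tendsto.sub (tendsto_const_nhds (x := (1 : ENNReal)) (f := atTop)) hcompl
    (Or.inl ENNReal.one_ne_top)
  simpa using this
end
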